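/- Given ε > 0 and t ∈ ℕ, there exists n₀ ∈ ℕ such that for every ε-wicked reduced hypergraph 𝒜 whose index set has size at least n₀, there exist a reduced hypergraph 𝒜⋆ with index set of size at least t not supporting a K₅⁽³⁾ and a bicolouring φ of 𝒜⋆ such that τ₂(𝒜⋆, φ) ≥ 1/3 + ε/8. -/

import Mathlib

open Finset Classical

noncomputable section

/-- A reduced hypergraph: a finite (linearly ordered, here `ℕ`) index set `I`,
pairwise disjoint nonempty finite vertex classes `P i j` for distinct `i j ∈ I`,
and for each triple of distinct indices a tripartite 3-uniform constituent,
encoded by a symmetric edge predicate on vertices. -/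
structure ReducedHG where
  I : Finset ℕ
  P : ℕ → ℕ → Finset ℕ
  Psymm : ∀ i j, P i j = P j i
  Pnonempty : ∀ i j, i ∈ I → j ∈ I → i ≠ j → (P i j).Nonempty
  Pdisjoint : ∀ i j k l, i ≠ j → k ≠ l → ({i, j} : Finset ℕ) ≠ ({k, l} : Finset ℕ) →
      Disjoint (P i j) (P k l)
  Edge : ℕ → ℕ → ℕ → Prop
  EdgeSymm : ∀ a b c, Edge a b c → Edge b a c
  EdgeSymm' : ∀ a b c, Edge a b c → Edge a c b
  EdgeValid : ∀ a b c, Edge a b c → ∃ i j k, i ∈ I ∧ j ∈ I ∧ k ∈ I ∧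
      i ≠ j ∧ i ≠ k ∧ j ≠ k ∧ a ∈ P i j ∧ b ∈ P i k ∧ c ∈ P j k

namespace ReducedHG

variable (A : ReducedHG)

/-- The neighbourhood, inside the vertex class `P j k`, of two vertices `a`, `b`. -/
def nbhd (j k : ℕ) (a b : ℕ) : Finset ℕ := (A.P j k).filter fun c => A.Edge a b c

/-- The number of crossing edges between three vertex sets. -/
def ecount (X Y Z : Finset ℕ) : ℕ :=
  ((X ×ˢ Y ×ˢ Z).filter fun t => A.Edge t.1 t.2.1 t.2.2).card

/-- `(d, ee)`-density: every pair of vertices sharing an index has large degree. -/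
def EEDense (d : ℝ) : Prop :=
  ∀ i j k, i ∈ A.I → j ∈ A.I → k ∈ A.I → i ≠ j → i ≠ k → j ≠ k →
    ∀ a ∈ A.P i j, ∀ b ∈ A.P i k,
      d * ((A.P j k).card : ℝ) ≤ ((A.nbhd j k a b).card : ℝ)

/-- `(μ, vvv)`-density: every constituent has many edges. -/
def VVVDense (μ : ℝ) : Prop :=
  ∀ i j k, i ∈ A.I → j ∈ A.I → k ∈ A.I → i ≠ j → i ≠ k → j ≠ k →
    μ * (((A.P i j).card : ℝ) * ((A.P i k).card : ℝ) * ((A.P j k).card : ℝ)) ≤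
      (A.ecount (A.P i j) (A.P i k) (A.P j k) : ℝ)

/-- The reduced hypergraph supports a `K₅⁽³⁾`. -/
def SupportsK5 : Prop :=
  ∃ J ⊆ A.I, J.card = 5 ∧ ∃ f : ℕ → ℕ → ℕ,
    (∀ i ∈ J, ∀ j ∈ J, f i j = f j i) ∧
    (∀ i ∈ J, ∀ j ∈ J, i ≠ j → f i j ∈ A.P i j) ∧
    (∀ i ∈ J, ∀ j ∈ J, ∀ k ∈ J, i ≠ j → i ≠ k → j ≠ k →
      A.Edge (f i j) (f i k) (f j k))

/-- `ε`-wicked: `(1/3 + ε, ee)`-dense and not supporting a `K₅⁽³⁾`. -/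
def Wicked (ε : ℝ) : Prop := A.EEDense (1/3 + ε) ∧ ¬ A.SupportsK5

/-- A `J`-transversal: one vertex in each class `P i j`, `ij ∈ J⁽²⁾`. -/
def IsTransversal (J : Finset ℕ) (Q : ℕ → ℕ → ℕ) : Prop :=
  (∀ i ∈ J, ∀ j ∈ J, Q i j = Q j i) ∧ ∀ i ∈ J, ∀ j ∈ J, i ≠ j → Q i j ∈ A.P i j

/-- A `(K, L)`-transversal: one vertex in each class `P k l`, `(k, l) ∈ K × L`. -/
def IsTransversal2 (K L : Finset ℕ) (Q : ℕ → ℕ → ℕ) : Prop :=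
  ∀ k ∈ K, ∀ l ∈ L, Q k l ∈ A.P k l

/-- An inhabited triple of `J`-transversals. -/
def InhabitedTriple (J : Finset ℕ) (Q R S : ℕ → ℕ → ℕ) : Prop :=
  ∀ i ∈ J, ∀ j ∈ J, ∀ k ∈ J, i < j → j < k → A.Edge (Q i j) (R i k) (S j k)

/-- An inhabited triple consisting of a `(K,L)`-, a `(K,M)`- and an `(L,M)`-transversal. -/
def InhabitedTriple2 (K L M : Finset ℕ) (Q R S : ℕ → ℕ → ℕ) : Prop :=
  ∀ k ∈ K, ∀ l ∈ L, ∀ m ∈ M, A.Edge (Q k l) (R k m) (S l m)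

/-- `Φ` is a `μ`-hole on `J`. -/
def IsHole (μ : ℝ) (J : Finset ℕ) (Φ : Finset ℕ) : Prop :=
  (∀ i ∈ J, ∀ j ∈ J, i ≠ j → (Φ ∩ A.P i j).Nonempty) ∧
  ∀ i ∈ J, ∀ j ∈ J, ∀ k ∈ J, i ≠ j → i ≠ k → j ≠ k →
    (A.ecount (Φ ∩ A.P i j) (Φ ∩ A.P i k) (Φ ∩ A.P j k) : ℝ) ≤
      μ * (((A.P i j).card : ℝ) * ((A.P i k).card : ℝ) * ((A.P j k).card : ℝ))

/-- `Φ` is a `(μ, ϑ)`-hole on `J` (a `μ`-hole of width at least `ϑ`). -/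
def IsHoleW (μ ϑ : ℝ) (J : Finset ℕ) (Φ : Finset ℕ) : Prop :=
  A.IsHole μ J Φ ∧ ∀ i ∈ J, ∀ j ∈ J, i ≠ j →
    ϑ * ((A.P i j).card : ℝ) ≤ (((Φ ∩ A.P i j)).card : ℝ)

/-- Two holes are `ε`-intersecting on `J`. -/
def HolesIntersecting (ε : ℝ) (J : Finset ℕ) (Φ Ψ : Finset ℕ) : Prop :=
  ∀ i ∈ J, ∀ j ∈ J, i ≠ j →
    ε * ((A.P i j).card : ℝ) ≤ ((Φ ∩ Ψ ∩ A.P i j).card : ℝ)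

/-- Two holes are `ε`-disjoint on `J`. -/
def HolesDisjoint (ε : ℝ) (J : Finset ℕ) (Φ Ψ : Finset ℕ) : Prop :=
  ∀ i ∈ J, ∀ j ∈ J, i ≠ j →
    ((Φ ∩ Ψ ∩ A.P i j).card : ℝ) < ε * ((A.P i j).card : ℝ)

/-- The link on `K` of the family `k ↦ f k`, where `f k` is a vertex in a class `P k ·`:
`⋃_{k ≠ k' ∈ K} N(f k, f k')`. -/
def link (K : Finset ℕ) (f : ℕ → ℕ) : Finset ℕ :=
  ((K ×ˢ K).filter fun p => p.1 ≠ p.2).biUnion fun p => A.nbhd p.1 p.2 (f p.1) (f p.2)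

/-- The pair consisting of a transversal `T` on `Sh × B` and a transversal `U` on `Sh × C`
has `δ`-intersecting links. -/
def IntersectingLinks (δ : ℝ) (Sh B C : Finset ℕ) (T U : ℕ → ℕ → ℕ) : Prop :=
  ∀ a ∈ Sh, ∀ a' ∈ Sh, a ≠ a' → ∀ b ∈ B, ∀ c ∈ C,
    δ * ((A.P a a').card : ℝ) ≤
      (((A.nbhd a a' (T a b) (T a' b)) ∩ (A.nbhd a a' (U a c) (U a' c))).card : ℝ)

/-- The pair consisting of a transversal `T` on `Sh × B` and a transversal `U` on `Sh × C`
has `δ`-disjoint links. -/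
def DisjointLinks (δ : ℝ) (Sh B C : Finset ℕ) (T U : ℕ → ℕ → ℕ) : Prop :=
  ∀ a ∈ Sh, ∀ a' ∈ Sh, a ≠ a' → ∀ b ∈ B, ∀ c ∈ C,
    (((A.nbhd a a' (T a b) (T a' b)) ∩ (A.nbhd a a' (U a c) (U a' c))).card : ℝ) <
      δ * ((A.P a a').card : ℝ)

/-- A bicolouring of the reduced hypergraph: both colours appear in every vertex class and
no edge is monochromatic. -/
def IsBicolouring (φ : ℕ → Bool) : Prop :=
  (∀ i ∈ A.I, ∀ j ∈ A.I, i ≠ j →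
    (∃ v ∈ A.P i j, φ v = true) ∧ (∃ v ∈ A.P i j, φ v = false)) ∧
  ∀ a b c, A.Edge a b c → ¬ (φ a = φ b ∧ φ b = φ c)

/-- The minimum monochromatic codegree density is at least `x`: `τ₂(A, φ) ≥ x`. -/
def Tau2Ge (φ : ℕ → Bool) (x : ℝ) : Prop :=
  ∀ i j k, i ∈ A.I → j ∈ A.I → k ∈ A.I → i ≠ j → i ≠ k → j ≠ k →
    ∀ a ∈ A.P i j, ∀ b ∈ A.P i k, φ a = φ b →
      x * ((A.P j k).card : ℝ) ≤ ((A.nbhd j k a b).card : ℝ)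

/-- The `γ`-bad left cherries (both vertices in one hole, many neighbours outside
the other hole). -/
def badLeft (Φ Ψ : Finset ℕ) (γ : ℝ) (i j k : ℕ) : Finset (ℕ × ℕ) :=
  (A.P i j ×ˢ A.P i k).filter fun p =>
    (p.1 ∈ Φ ∧ p.2 ∈ Φ ∧ γ * ((A.P j k).card : ℝ) ≤ (((A.nbhd j k p.1 p.2) \ Ψ).card : ℝ)) ∨
    (p.1 ∈ Ψ ∧ p.2 ∈ Ψ ∧ γ * ((A.P j k).card : ℝ) ≤ (((A.nbhd j k p.1 p.2) \ Φ).card : ℝ))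

/-- The `γ`-bad middle cherries. -/
def badMid (Φ Ψ : Finset ℕ) (γ : ℝ) (i j k : ℕ) : Finset (ℕ × ℕ) :=
  (A.P i j ×ˢ A.P j k).filter fun p =>
    (p.1 ∈ Φ ∧ p.2 ∈ Φ ∧ γ * ((A.P i k).card : ℝ) ≤ (((A.nbhd i k p.1 p.2) \ Ψ).card : ℝ)) ∨
    (p.1 ∈ Ψ ∧ p.2 ∈ Ψ ∧ γ * ((A.P i k).card : ℝ) ≤ (((A.nbhd i k p.1 p.2) \ Φ).card : ℝ))

/-- The `γ`-bad right cherries. -/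
def badRight (Φ Ψ : Finset ℕ) (γ : ℝ) (i j k : ℕ) : Finset (ℕ × ℕ) :=
  (A.P i k ×ˢ A.P j k).filter fun p =>
    (p.1 ∈ Φ ∧ p.2 ∈ Φ ∧ γ * ((A.P i j).card : ℝ) ≤ (((A.nbhd i j p.1 p.2) \ Ψ).card : ℝ)) ∨
    (p.1 ∈ Ψ ∧ p.2 ∈ Ψ ∧ γ * ((A.P i j).card : ℝ) ≤ (((A.nbhd i j p.1 p.2) \ Φ).card : ℝ))

end ReducedHG

section
theorem preramsey {κ : Type} [Fintype κ] [Nonempty κ] (n : ℕ) : ∃ N, ∀ V : Finset ℕ, N ≤ V.card →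
    ∀ χ : ℕ → ℕ → κ, ∃ W ⊆ V, W.card = n ∧ ∃ g : ℕ → κ, ∀ u ∈ W, ∀ u' ∈ W, u < u' → χ u u' = g u := by
  induction n with
  | zero =>
    refine ⟨0, fun V _ χ => ⟨∅, by simp, by simp, fun _ => Classical.arbitrary κ, by simp⟩⟩
  | succ n ih =>
    obtain ⟨N, hN⟩ := ih
    refine ⟨Fintype.card κ * N + 1, fun V hV χ => ?_⟩
    have hne : V.Nonempty := by
      rw [← Finset.card_pos]; omega
    set u0 := V.min' hne with hu0
    have hu0V : u0 ∈ V := V.min'_mem hne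
    have hc : (V.erase u0).card = V.card - 1 := Finset.card_erase_of_mem hu0V
    obtain ⟨c, -, hc'⟩ := Finset.exists_le_card_fiber_of_mul_le_card_of_maps_to
      (s := V.erase u0) (t := (Finset.univ : Finset κ)) (f := fun u => χ u0 u) (n := N)
      (fun a _ => Finset.mem_univ _) Finset.univ_nonempty (by rw [Finset.card_univ, hc]; omega)
    obtain ⟨W, hWs, hWc, g, hg⟩ := hN _ hc' χ
    have hWV : ∀ w ∈ W, w ∈ V ∧ w ≠ u0 ∧ χ u0 w = c := by
      intro w hw
      have := hWs hw
      simp only [Finset.mem_filter, Finset.mem_erase] at this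
      exact ⟨this.1.2, this.1.1, this.2⟩
    have hnot : u0 ∉ W := fun h => (hWV _ h).2.1 rfl
    refine ⟨insert u0 W, ?_, ?_, fun u => if u = u0 then c else g u, ?_⟩
    · intro x hx
      rcases Finset.mem_insert.1 hx with rfl | hx
      · exact hu0V
      · exact (hWV _ hx).1
    · rw [Finset.card_insert_of_notMem hnot, hWc]
    · intro u hu u' hu' huu
      rcases Finset.mem_insert.1 hu with rfl | hu
      · rcases Finset.mem_insert.1 hu' with rfl | hu'
        · exact absurd huu (lt_irrefl _)
        · simp [(hWV _ hu').2.2]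
      · rcases Finset.mem_insert.1 hu' with rfl | hu'
        · have := V.min'_le _ (hWV _ hu).1
          omega
        · simp only [(hWV _ hu).2.1, if_false]
          exact hg u hu u' hu' huu

theorem ramsey (κ : Type) [Fintype κ] [Nonempty κ] (m : ℕ) : ∃ N, ∀ V : Finset ℕ, N ≤ V.card →
    ∀ χ : ℕ → ℕ → κ, ∃ W ⊆ V, W.card = m ∧ ∃ c, ∀ u ∈ W, ∀ u' ∈ W, u < u' → χ u u' = c := by
  obtain ⟨N, hN⟩ := preramsey (κ := κ) (Fintype.card κ * m)
  refine ⟨N, fun V hV χ => ?_⟩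
  obtain ⟨W, hWs, hWc, g, hg⟩ := hN V hV χ
  obtain ⟨c, -, hc'⟩ := Finset.exists_le_card_fiber_of_mul_le_card_of_maps_to
      (s := W) (t := (Finset.univ : Finset κ)) (f := g) (n := m)
      (fun a _ => Finset.mem_univ _) Finset.univ_nonempty (by rw [Finset.card_univ, hWc])
  obtain ⟨W', hW', hW'c⟩ := Finset.exists_subset_card_eq hc'
  have h1 : ∀ w ∈ W', w ∈ W ∧ g w = c := fun w hw => Finset.mem_filter.1 (hW' hw)
  exact ⟨W', fun w hw => hWs (h1 w hw).1, hW'c, c, fun u hu u' hu' h =>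
    (hg u (h1 u hu).1 u' (h1 u' hu').1 h).trans (h1 u hu).2⟩

theorem ramseyMulti (κ : Type) [Fintype κ] [Nonempty κ] (n m : ℕ) : ∃ N, ∀ (α : Type) (V : Finset ℕ),
    N ≤ V.card → ∀ Q : Finset α, Q.card ≤ n → ∀ χ : α → ℕ → ℕ → κ,
      ∃ W ⊆ V, m ≤ W.card ∧ ∃ c : α → κ, ∀ a ∈ Q, ∀ u ∈ W, ∀ u' ∈ W, u < u' → χ a u u' = c a := by
  induction n with
  | zero =>
    refine ⟨m, fun α V hV Q hQ χ => ⟨V, subset_rfl, hV, fun _ => Classical.arbitrary κ, ?_⟩⟩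
    have : Q = ∅ := Finset.card_eq_zero.1 (by omega)
    simp [this]
  | succ n ih =>
    obtain ⟨N, hN⟩ := ih
    obtain ⟨N', hN'⟩ := ramsey κ N
    refine ⟨max N' m, fun α V hV Q hQ χ => ?_⟩
    rcases Q.eq_empty_or_nonempty with rfl | ⟨a0, ha0⟩
    · exact ⟨V, subset_rfl, le_trans (le_max_right _ _) hV, fun _ => Classical.arbitrary κ, by simp⟩
    obtain ⟨W, hWs, hWc, c0, hc0⟩ := hN' V (le_trans (le_max_left _ _) hV) (χ a0)
    obtain ⟨W', hW's, hW'c, c, hc⟩ := hN α W hWc.ge (Q.erase a0) (by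
      rw [Finset.card_erase_of_mem ha0]; omega) χ
    refine ⟨W', hW's.trans hWs, hW'c, fun a => if a = a0 then c0 else c a, ?_⟩
    intro a ha u hu u' hu' h
    by_cases haa : a = a0
    · subst haa; simp [hc0 u (hW's hu) u' (hW's hu') h]
    · simp only [haa, if_false]
      exact hc a (Finset.mem_erase.2 ⟨haa, ha⟩) u hu u' hu' h

theorem box (q : ℕ) : ∀ (d : ℝ), 0 < d → ∀ m : ℕ, ∃ n : Fin q → ℕ, ∀ K : Fin q → Finset ℕ,
    (∀ i, (K i).card = n i) → ∀ G ⊆ Fintype.piFinset K,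
    d * ((Fintype.piFinset K).card : ℝ) ≤ (G.card : ℝ) →
    ∃ K' : Fin q → Finset ℕ, (∀ i, K' i ⊆ K i) ∧ (∀ i, (K' i).card = m) ∧
      Fintype.piFinset K' ⊆ G := by
  induction q with
  | zero =>
    intro d hd m
    refine ⟨fun _ => 0, fun K _ G hG hd' => ⟨K, fun i => subset_rfl, fun i => i.elim0, ?_⟩⟩
    have h1 : (Fintype.piFinset K).card = 1 := by simp
    rw [h1] at hd'
    have : 0 < G.card := by
      have : (0:ℝ) < G.card := by push_cast at hd'; linarith
      exact_mod_cast this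
    rw [Finset.eq_of_subset_of_card_le hG (by omega)]
  | succ q ih =>
    intro d hd m
    obtain ⟨n0, hn0⟩ := exists_nat_ge (2 * (m:ℝ) / d)
    have hn0' : 2 * (m:ℝ) ≤ d * (n0 + 1 + m : ℕ) := by
      rw [div_le_iff₀ hd] at hn0; push_cast
      have : 0 ≤ d * m := by positivity
      nlinarith
    set M := n0 + 1 + m with hM
    have hMpos : (0:ℝ) < M := by rw [hM]; push_cast; positivity
    obtain ⟨n, hn⟩ := ih (d / 2 / 2 ^ M) (by positivity) m
    refine ⟨Fin.cons M n, fun K hK G hG hGd => ?_⟩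
    have hK0 : (K 0).card = M := by simpa using hK 0
    have hKt : ∀ i, (Fin.tail K i).card = n i := by
      intro i; simpa [Fin.tail] using hK i.succ
    set T := Fintype.piFinset (Fin.tail K) with hT
    have hmemc : ∀ u z, (Fin.cons u z : Fin (q+1) → ℕ) ∈ Fintype.piFinset K ↔ u ∈ K 0 ∧ z ∈ T := by
      intro u z
      rw [Fin.mem_piFinset_iff_zero_tail]; simp [hT]
    have hcard : (Fintype.piFinset K).card = M * T.card := by
      rw [Fintype.card_piFinset, Fin.prod_univ_succ, hT, Fintype.card_piFinset, hK0]; rfl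
    let deg : (Fin q → ℕ) → Finset ℕ := fun z => (K 0).filter fun u => (Fin.cons u z : Fin (q+1) → ℕ) ∈ G
    have hsum : G.card = ∑ z ∈ T, (deg z).card := by
      rw [Finset.card_eq_sum_card_fiberwise (f := fun x => Fin.tail x) (t := T)]
      · refine Finset.sum_congr rfl fun z hz => ?_
        refine Finset.card_bij (fun x _ => x 0) ?_ ?_ ?_
        · intro x hx
          simp only [Finset.mem_filter] at hx
          have := (Fin.mem_piFinset_iff_zero_tail.1 (hG hx.1)).1
          simp only [deg, Finset.mem_filter]
          refine ⟨this, ?_⟩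
          rw [← hx.2, Fin.cons_self_tail]; exact hx.1
        · intro x hx y hy hxy
          simp only [Finset.mem_filter] at hx hy
          rw [← Fin.cons_self_tail x, ← Fin.cons_self_tail y, hx.2, hy.2, hxy]
        · intro u hu
          simp only [deg, Finset.mem_filter] at hu
          refine ⟨Fin.cons u z, ?_, by simp⟩
          simp [hu.2]
      · intro x hx
        exact (Fin.mem_piFinset_iff_zero_tail.1 (hG hx)).2
    let Z := T.filter fun z => m ≤ (deg z).card
    have hub : (G.card : ℝ) ≤ Z.card * M + m * T.card := by
      have : G.card ≤ Z.card * M + m * T.card := by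
        rw [hsum, ← Finset.sum_filter_add_sum_filter_not T (fun z => m ≤ (deg z).card)]
        refine add_le_add ?_ ?_
        · refine (Finset.sum_le_card_nsmul _ _ M fun z _ => ?_).trans (by simp [Z])
          rw [← hK0]; exact Finset.card_filter_le _ _
        · refine (Finset.sum_le_card_nsmul _ _ m fun z hz => ?_).trans ?_
          · simp only [Finset.mem_filter] at hz; omega
          · rw [smul_eq_mul, mul_comm]; exact Nat.mul_le_mul_left _ (Finset.card_filter_le _ _)
      exact_mod_cast this
    have hZ : d / 2 * T.card ≤ Z.card := by
      rw [hcard] at hGd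
      push_cast at hGd
      have hTn : (0:ℝ) ≤ T.card := by positivity
      have h1 : (d/2 * T.card) * M ≤ Z.card * M := by nlinarith
      exact le_of_mul_le_mul_right h1 hMpos
    have hex : ∀ z ∈ Z, ∃ S ⊆ deg z, S.card = m := fun z hz =>
      Finset.exists_subset_card_eq (Finset.mem_filter.1 hz).2
    choose! S hS hSc using hex
    have hmaps : ∀ z ∈ Z, S z ∈ (K 0).powerset := fun z hz =>
      Finset.mem_powerset.2 ((hS z hz).trans (Finset.filter_subset _ _))
    obtain ⟨S0, hS0, hS0c⟩ := Finset.exists_le_card_fiber_of_nsmul_le_card_of_maps_to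
      (M := ℝ) (s := Z) (t := (K 0).powerset) (f := S) (b := d / 2 / 2 ^ M * T.card) hmaps ⟨∅, by simp⟩ (by
        rw [Finset.card_powerset, hK0, nsmul_eq_mul]
        push_cast
        refine le_trans (le_of_eq ?_) hZ
        field_simp)
    obtain ⟨K', hK's, hK'c, hK'G⟩ := hn (Fin.tail K) hKt (Z.filter fun z => S z = S0)
      (fun z hz => (Finset.mem_filter.1 (Finset.mem_filter.1 hz).1).1) hS0c
    by_cases hemp : (Z.filter fun z => S z = S0).Nonempty
    · obtain ⟨z0, hz0⟩ := hemp
      have hz0' := Finset.mem_filter.1 hz0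
      refine ⟨Fin.cons S0 K', ?_, ?_, ?_⟩
      · intro i
        refine Fin.cases ?_ (fun i => ?_) i
        · simpa using Finset.mem_powerset.1 hS0
        · simpa [Fin.tail] using hK's i
      · intro i
        refine Fin.cases ?_ (fun i => ?_) i
        · simp [← hz0'.2, hSc z0 hz0'.1]
        · simpa using hK'c i
      · intro x hx
        rw [← Fin.cons_self_tail x] at hx ⊢
        rw [Fin.cons_mem_piFinset_cons] at hx
        have h2 := Finset.mem_filter.1 (hK'G hx.2)
        have h3 := hS _ h2.1 (h2.2.symm ▸ hx.1)
        exact (Finset.mem_filter.1 h3).2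
    · rw [Finset.not_nonempty_iff_eq_empty] at hemp
      rw [hemp, Finset.card_empty] at hS0c
      have hT0 : T.card = 0 := by
        by_contra h
        have : (0:ℝ) < T.card := by exact_mod_cast Nat.pos_of_ne_zero h
        have : 0 < d / 2 / 2 ^ M * T.card := by positivity
        push_cast at hS0c
        linarith
      -- G empty, but then choose subset of K 0
      rw [hemp] at hK'G
      have hle : m ≤ (K 0).card := by
        rw [hK0]; omega
      obtain ⟨S1, hS1, hS1c⟩ := Finset.exists_subset_card_eq hle
      refine ⟨Fin.cons S1 K', ?_, ?_, ?_⟩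
      · intro i
        refine Fin.cases ?_ (fun i => ?_) i
        · simpa using hS1
        · simpa [Fin.tail] using hK's i
      · intro i
        refine Fin.cases ?_ (fun i => ?_) i
        · simpa using hS1c
        · simpa using hK'c i
      · intro x hx
        rw [← Fin.cons_self_tail x] at hx
        rw [Fin.cons_mem_piFinset_cons] at hx
        have := hK'G hx.2
        simp at this
end

section
def Big {q : ℕ} (m : ℕ) (K : Fin q → Finset ℕ) : Prop := ∀ i, m ≤ (K i).card

theorem Big.mono {q m m' : ℕ} {K : Fin q → Finset ℕ} (h : Big m K) (hm : m' ≤ m) : Big m' K :=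
  fun i => hm.trans (h i)

theorem trim {q : ℕ} {K : Fin q → Finset ℕ} (n : Fin q → ℕ) (h : ∀ i, n i ≤ (K i).card) :
    ∃ K' ≤ K, ∀ i, (K' i).card = n i := by
  choose K' h1 h2 using fun i => Finset.exists_subset_card_eq (h i)
  exact ⟨K', h1, h2⟩

theorem Big.nonempty {q m : ℕ} {K : Fin q → Finset ℕ} (h : Big m K) (hm : 1 ≤ m) (i : Fin q) :
    (K i).Nonempty := Finset.card_pos.1 (lt_of_lt_of_le hm (h i))

theorem boxColor (q : ℕ) (κ : Type) [Fintype κ] [Nonempty κ] (m : ℕ) : ∃ N, ∀ K : Fin q → Finset ℕ,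
    Big N K → ∀ Q : κ → (Fin q → ℕ) → Prop, (∀ a ∈ Fintype.piFinset K, ∃ k, Q k a) →
    ∃ K' ≤ K, Big m K' ∧ ∃ k, ∀ a ∈ Fintype.piFinset K', Q k a := by
  have hκ : (0:ℝ) < Fintype.card κ := by exact_mod_cast Fintype.card_pos
  obtain ⟨n, hn⟩ := box q (1 / Fintype.card κ) (by positivity) m
  refine ⟨Finset.univ.sup n, fun K hK Q hQ => ?_⟩
  obtain ⟨K0, hK0, hK0c⟩ := trim (K := K) n (fun i => (Finset.le_sup (Finset.mem_univ i)).trans (hK i))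
  have hsub : Fintype.piFinset K0 ⊆ Fintype.piFinset K := Fintype.piFinset_subset _ _ hK0
  choose! c hc using fun a (ha : a ∈ Fintype.piFinset K0) => hQ a (hsub ha)
  obtain ⟨k, -, hk⟩ := Finset.exists_le_card_fiber_of_nsmul_le_card_of_maps_to
    (M := ℝ) (s := Fintype.piFinset K0) (t := (Finset.univ : Finset κ)) (f := c)
    (b := 1 / Fintype.card κ * (Fintype.piFinset K0).card) (fun _ _ => Finset.mem_univ _)
    Finset.univ_nonempty (by rw [Finset.card_univ, nsmul_eq_mul]; apply le_of_eq; field_simp)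
  obtain ⟨K', h1, h2, h3⟩ := hn K0 hK0c _ (Finset.filter_subset _ _) hk
  refine ⟨K', le_trans h1 hK0, fun i => (h2 i).ge, k, fun a ha => ?_⟩
  have := Finset.mem_filter.1 (h3 ha)
  exact this.2 ▸ hc a this.1

theorem homPair (q : ℕ) (i : Fin q) (m : ℕ) : ∃ N, ∀ K : Fin q → Finset ℕ,
    Big N K → ∀ χ : (Fin q → ℕ) → ℕ → ℕ → Bool,
    ∃ K' ≤ K, Big m K' ∧ ∃ c, ∀ a ∈ Fintype.piFinset K', ∀ u ∈ K' i, ∀ u' ∈ K' i, u < u' →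
      χ (Function.update a i 0) u u' = c := by
  obtain ⟨N1, hN1, h1⟩ : ∃ N, N ≠ 0 ∧ ∀ K : Fin q → Finset ℕ,
    Big N K → ∀ Q : Bool → (Fin q → ℕ) → Prop, (∀ a ∈ Fintype.piFinset K, ∃ k, Q k a) →
    ∃ K' ≤ K, Big m K' ∧ ∃ k, ∀ a ∈ Fintype.piFinset K', Q k a := by
    obtain ⟨N, h⟩ := boxColor q Bool m
    exact ⟨N + 1, by omega, fun K hK => h K (hK.mono (by omega))⟩
  obtain ⟨N2, h2⟩ := ramseyMulti Bool (N1 ^ q) N1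
  refine ⟨max N1 N2, fun K hK χ => ?_⟩
  obtain ⟨K0, hK0, hK0c⟩ := trim (K := K) (fun _ => N1) (fun i => (le_max_left _ _).trans (hK i))
  obtain ⟨W, hWs, hWc, c, hc⟩ := h2 _ (K i) ((le_max_right _ _).trans (hK i))
    ((Fintype.piFinset K0).image fun a => Function.update a i 0) (by
      refine Finset.card_image_le.trans ?_
      rw [Fintype.card_piFinset, Finset.prod_congr rfl (fun i _ => hK0c i)]; simp) χ
  have hKK : Function.update K0 i W ≤ K := by
    intro l
    by_cases h : l = i
    · subst h; simpa using hWs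
    · simpa [h] using hK0 l
  obtain ⟨K', h3, h4, k, h5⟩ := h1 (Function.update K0 i W) (by
    intro l
    by_cases h : l = i
    · subst h; simpa using hWc
    · simp [h, hK0c]) (fun k a => c (Function.update a i 0) = k) (fun a _ => ⟨_, rfl⟩)
  refine ⟨K', h3.trans hKK, h4, k, fun a ha u hu u' hu' huu => ?_⟩
  rw [← h5 a ha]
  have hW : ∀ x ∈ K' i, x ∈ W := fun x hx => by simpa using h3 i hx
  refine hc _ ?_ u (hW _ hu) u' (hW _ hu') huu
  obtain ⟨y, hy⟩ : (K0 i).Nonempty := Finset.card_pos.1 (by rw [hK0c]; omega)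
  refine Finset.mem_image.2 ⟨Function.update a i y, ?_, by simp⟩
  rw [Fintype.mem_piFinset]
  intro l
  by_cases h : l = i
  · subst h; simpa using hy
  · have := h3 l (Fintype.mem_piFinset.1 ha l)
    simpa [h] using this

/-- popular choice -/
theorem pop_core {α β : Type} (ε : ℝ) (hε : 0 < ε) (S : Finset α) (X : Finset β) (P : α → Finset ℕ)
    (G : α → β → Finset ℕ) (hG : ∀ p ∈ S, ∀ x ∈ X, G p x ⊆ P p)
    (hPne : ∀ p ∈ S, (P p).Nonempty)
    (hd : ∀ p ∈ S, ∀ x ∈ X, ε * ((P p).card : ℝ) ≤ ((G p x).card : ℝ)) :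
    ∃ X' ⊆ X, ε ^ S.card * (X.card : ℝ) ≤ (X'.card : ℝ) ∧ ∃ Y : α → ℕ, ∀ p ∈ S, Y p ∈ P p ∧ 
      ∀ x ∈ X', Y p ∈ G p x := by
  induction S using Finset.induction_on with
  | empty => exact ⟨X, subset_rfl, by simp, fun _ => 0, by simp⟩
  | insert p S hp ih =>
    obtain ⟨X1, hX1, hc1, Y, hY⟩ := ih (fun r hr => hG r (Finset.mem_insert_of_mem hr))
      (fun r hr => hPne r (Finset.mem_insert_of_mem hr)) (fun r hr => hd r (Finset.mem_insert_of_mem hr))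
    have hpi := Finset.mem_insert_self p S
    -- double count
    have hdc : ∑ y ∈ P p, ((X1.filter fun x => y ∈ G p x).card : ℝ) = ∑ x ∈ X1, ((G p x).card : ℝ) := by
      have := Finset.sum_card_bipartiteAbove_eq_sum_card_bipartiteBelow (s := P p) (t := X1)
        (fun y x => y ∈ G p x)
      have h2 : ∀ x ∈ X1, (Finset.bipartiteBelow (fun y x => y ∈ G p x) (P p) x) = G p x := by
        intro x hx
        ext y
        simp only [Finset.mem_bipartiteBelow]
        exact ⟨fun h => h.2, fun h => ⟨hG p hpi x (hX1 hx) h, h⟩⟩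
      have h3 : ∑ x ∈ X1, (G p x).card = ∑ y ∈ P p, (X1.filter fun x => y ∈ G p x).card := by
        rw [Finset.sum_congr rfl (fun x hx => by rw [← h2 x hx])]
        exact this.symm
      exact_mod_cast h3.symm
    obtain ⟨y, hy, hyc⟩ : ∃ y ∈ P p, ε * X1.card ≤ ((X1.filter fun x => y ∈ G p x).card : ℝ) := by
      refine Finset.exists_le_of_sum_le (hPne p hpi) ?_
      rw [hdc, Finset.sum_const, nsmul_eq_mul]
      have := Finset.card_nsmul_le_sum X1 (fun x => ((G p x).card : ℝ)) (ε * (P p).card)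
        (fun x hx => hd p hpi x (hX1 hx))
      rw [nsmul_eq_mul] at this
      linarith
    refine ⟨X1.filter fun x => y ∈ G p x, (Finset.filter_subset _ _).trans hX1, ?_,
      fun r => if r = p then y else Y r, ?_⟩
    · rw [Finset.card_insert_of_notMem hp, pow_succ]
      nlinarith
    · intro r hr
      rcases Finset.mem_insert.1 hr with rfl | hr
      · simp only [if_true]
        exact ⟨hy, fun x hx => (Finset.mem_filter.1 hx).2⟩
      · have : r ≠ p := fun h => hp (h ▸ hr)
        simp only [this, if_false]
        exact ⟨(hY r hr).1, fun x hx => (hY r hr).2 x (Finset.mem_filter.1 hx).1⟩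

/-- pigeonhole for large sets -/
theorem two_meet {β : Type} (ε : ℝ) (X : Finset β) (P : Finset ℕ) (hP : P.Nonempty) (G : β → Finset ℕ)
    (hG : ∀ x ∈ X, G x ⊆ P) (hd : ∀ x ∈ X, ε * (P.card : ℝ) ≤ ((G x).card : ℝ))
    (hX : 1 < ε * X.card) : ∃ x ∈ X, ∃ x' ∈ X, x ≠ x' ∧ ∃ y, y ∈ G x ∧ y ∈ G x' := by
  by_contra hcon
  push Not at hcon
  have hdisj : (X : Set β).PairwiseDisjoint G := by
    intro x hx x' hx' hne
    exact Finset.disjoint_left.2 fun y hy hy' => hcon x hx x' hx' hne y hy hy'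
  have h1 : (X.biUnion G).card ≤ P.card := Finset.card_le_card (Finset.biUnion_subset.2 hG)
  rw [Finset.card_biUnion hdisj] at h1
  have h2 : ((∑ x ∈ X, (G x).card : ℕ) : ℝ) ≤ P.card := by exact_mod_cast h1
  push_cast at h2
  have := Finset.card_nsmul_le_sum X (fun x => ((G x).card : ℝ)) (ε * P.card) hd
  rw [nsmul_eq_mul] at this
  have hPp : (0:ℝ) < P.card := by exact_mod_cast hP.card_pos
  nlinarith
end

section
variable {q : ℕ}

structure Sys (A : ReducedHG) (K : Fin q → Finset ℕ) : Prop where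
  sub : ∀ i, K i ⊆ A.I
  disj : ∀ i j, i ≠ j → Disjoint (K i) (K j)

theorem Sys.mono {A : ReducedHG} {K K' : Fin q → Finset ℕ} (h : Sys A K) (hK : K' ≤ K) : Sys A K' :=
  ⟨fun i => (hK i).trans (h.sub i), fun i j hij => (h.disj i j hij).mono (hK i) (hK j)⟩

theorem Sys.ne {A : ReducedHG} {K : Fin q → Finset ℕ} (h : Sys A K) {i j : Fin q} {a b : ℕ}
    (ha : a ∈ K i) (hb : b ∈ K j) (hij : i ≠ j) : a ≠ b :=
  fun e => Finset.disjoint_left.1 (h.disj i j hij) ha (e ▸ hb)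

structure Tr (A : ReducedHG) (T : ℕ → ℕ → ℕ) : Prop where
  symm : ∀ a b, T a b = T b a
  mem : ∀ a ∈ A.I, ∀ b ∈ A.I, a ≠ b → T a b ∈ A.P a b

theorem exists_Tr (A : ReducedHG) : ∃ T, Tr A T := by
  have h : ∀ a b, ∃ x, a ∈ A.I → b ∈ A.I → a ≠ b → x ∈ A.P a b := by
    intro a b
    by_cases h : a ∈ A.I ∧ b ∈ A.I ∧ a ≠ b
    · obtain ⟨x, hx⟩ := A.Pnonempty a b h.1 h.2.1 h.2.2
      exact ⟨x, fun _ _ _ => hx⟩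
    · exact ⟨0, fun h1 h2 h3 => absurd ⟨h1, h2, h3⟩ h⟩
  choose f hf using h
  refine ⟨fun a b => f (min a b) (max a b), fun a b => by simp [min_comm, max_comm], ?_⟩
  intro a ha b hb hab
  rcases lt_or_gt_of_ne hab with h | h
  · simpa [min_eq_left h.le, max_eq_right h.le] using hf a b ha hb hab
  · rw [A.Psymm]
    simpa [min_eq_right h.le, max_eq_left h.le] using hf b a hb ha hab.symm

def Meet (A : ReducedHG) (ε : ℝ) (K : Fin q → Finset ℕ) (i j : Fin q) (T : ℕ → ℕ → ℕ) (k : Fin q)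
    (U : ℕ → ℕ → ℕ) : Prop := A.IntersectingLinks ε (K i) (K j) (K k) T U
def Miss (A : ReducedHG) (ε : ℝ) (K : Fin q → Finset ℕ) (i j : Fin q) (T : ℕ → ℕ → ℕ) (k : Fin q)
    (U : ℕ → ℕ → ℕ) : Prop := A.DisjointLinks ε (K i) (K j) (K k) T U

section
variable {A : ReducedHG} {ε : ℝ} {K K' : Fin q → Finset ℕ} {i j k : Fin q} {T U V W : ℕ → ℕ → ℕ}

theorem Meet.mono (h : Meet A ε K i j T k U) (hK : K' ≤ K) : Meet A ε K' i j T k U :=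
  fun a ha a' ha' hne b hb c hc => h a (hK i ha) a' (hK i ha') hne b (hK j hb) c (hK k hc)
theorem Miss.mono (h : Miss A ε K i j T k U) (hK : K' ≤ K) : Miss A ε K' i j T k U :=
  fun a ha a' ha' hne b hb c hc => h a (hK i ha) a' (hK i ha') hne b (hK j hb) c (hK k hc)
theorem Meet.symm (h : Meet A ε K i j T k U) : Meet A ε K i k U j T := by
  intro a ha a' ha' hne b hb c hc
  rw [Finset.inter_comm]
  exact h a ha a' ha' hne c hc b hb
theorem Miss.symm (h : Miss A ε K i j T k U) : Miss A ε K i k U j T := by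
  intro a ha a' ha' hne b hb c hc
  rw [Finset.inter_comm]
  exact h a ha a' ha' hne c hc b hb

theorem edge_swap {A : ReducedHG} (a b c : ℕ) : A.Edge a b c ↔ A.Edge b a c :=
  ⟨A.EdgeSymm _ _ _, A.EdgeSymm _ _ _⟩
theorem edge_swap' {A : ReducedHG} (a b c : ℕ) : A.Edge a b c ↔ A.Edge a c b :=
  ⟨A.EdgeSymm' _ _ _, A.EdgeSymm' _ _ _⟩

theorem mem_nbhd {A : ReducedHG} {j k a b c : ℕ} : c ∈ A.nbhd j k a b ↔ c ∈ A.P j k ∧ A.Edge a b c := by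
  simp [ReducedHG.nbhd]

theorem nbhd_comm (A : ReducedHG) (j k a b : ℕ) : A.nbhd j k a b = A.nbhd k j b a := by
  ext c; rw [mem_nbhd, mem_nbhd, A.Psymm, edge_swap]

theorem nbhd_sub (A : ReducedHG) (j k a b : ℕ) : A.nbhd j k a b ⊆ A.P j k := Finset.filter_subset _ _

theorem exists_two {s : Finset ℕ} (h : 2 ≤ s.card) : ∃ a ∈ s, ∃ b ∈ s, a < b := by
  obtain ⟨a, ha, b, hb, hab⟩ := Finset.one_lt_card.1 h
  rcases lt_or_gt_of_ne hab with h | h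
  · exact ⟨a, ha, b, hb, h⟩
  · exact ⟨b, hb, a, ha, h⟩

theorem not_meet_miss (h : Meet A ε K i j T k U) (h' : Miss A ε K i j T k U) (hK : Big 2 K) : False := by
  obtain ⟨a, ha, a', ha', hlt⟩ := exists_two (hK i)
  obtain ⟨b, hb⟩ := hK.nonempty one_le_two j
  obtain ⟨c, hc⟩ := hK.nonempty one_le_two k
  exact absurd (h a ha a' ha' hlt.ne b hb c hc) (not_le.2 (h' a ha a' ha' hlt.ne b hb c hc))

theorem three_sets (ε : ℝ) (P X Y Z : Finset ℕ) (hX : X ⊆ P) (hY : Y ⊆ P) (hZ : Z ⊆ P)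
    (h1 : (1/3 + ε) * (P.card : ℝ) ≤ X.card) (h2 : (1/3 + ε) * (P.card : ℝ) ≤ Y.card)
    (h3 : (1/3 + ε) * (P.card : ℝ) ≤ Z.card) :
    ε * (P.card : ℝ) ≤ ((X ∩ Y).card : ℝ) ∨ ε * (P.card : ℝ) ≤ ((X ∩ Z).card : ℝ) ∨
      ε * (P.card : ℝ) ≤ ((Y ∩ Z).card : ℝ) := by
  by_contra hcon
  push Not at hcon
  have e1 := Finset.card_union_add_card_inter X Y
  have e2 := Finset.card_union_add_card_inter (X ∪ Y) Z
  have e3 : ((X ∪ Y) ∩ Z).card ≤ (X ∩ Z).card + (Y ∩ Z).card := by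
    rw [Finset.union_inter_distrib_right]; exact Finset.card_union_le _ _
  have e4 : (X ∪ Y ∪ Z).card ≤ P.card :=
    Finset.card_le_card (Finset.union_subset (Finset.union_subset hX hY) hZ)
  have e5 : X.card + Y.card + Z.card ≤ P.card + (X ∩ Y).card + (X ∩ Z).card + (Y ∩ Z).card := by omega
  have e6 : (X.card : ℝ) + Y.card + Z.card ≤ P.card + (X ∩ Y).card + (X ∩ Z).card + (Y ∩ Z).card := by
    exact_mod_cast e5
  linarith [hcon.1, hcon.2.1, hcon.2.2]

theorem link_card (hA : A.EEDense (1/3 + ε)) (hT : Tr A T) {a a' b : ℕ} (ha : a ∈ A.I) (ha' : a' ∈ A.I)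
    (hb : b ∈ A.I) (h1 : a ≠ a') (h2 : a ≠ b) (h3 : a' ≠ b) :
    (1/3 + ε) * ((A.P a a').card : ℝ) ≤ ((A.nbhd a a' (T a b) (T a' b)).card : ℝ) := by
  refine hA b a a' hb ha ha' h2.symm h3.symm h1 _ ?_ _ ?_
  · rw [hT.symm]; exact hT.mem b hb a ha h2.symm
  · rw [hT.symm]; exact hT.mem b hb a' ha' h3.symm

theorem meet_of_miss {w : Fin q} (hA : A.EEDense (1/3 + ε)) (hK : Sys A K) (hT : Tr A T) (hU : Tr A U)
    (hV : Tr A V) (hij : i ≠ j) (hik : i ≠ k) (hiw : i ≠ w) (hw : (K w).Nonempty)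
    (h1 : Miss A ε K i j T w V) (h2 : Miss A ε K i k U w V) : Meet A ε K i j T k U := by
  intro a ha a' ha' hne b hb c hc
  obtain ⟨d, hd⟩ := hw
  have h1' := h1 a ha a' ha' hne b hb d hd
  have h2' := h2 a ha a' ha' hne c hc d hd
  rcases three_sets ε (A.P a a') _ _ _ (nbhd_sub A a a' (T a b) (T a' b))
    (nbhd_sub A a a' (U a c) (U a' c)) (nbhd_sub A a a' (V a d) (V a' d))
    (link_card hA hT (hK.sub i ha) (hK.sub i ha') (hK.sub j hb) hne (hK.ne ha hb hij) (hK.ne ha' hb hij))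
    (link_card hA hU (hK.sub i ha) (hK.sub i ha') (hK.sub k hc) hne (hK.ne ha hc hik) (hK.ne ha' hc hik))
    (link_card hA hV (hK.sub i ha) (hK.sub i ha') (hK.sub w hd) hne (hK.ne ha hd hiw) (hK.ne ha' hd hiw))
    with h | h | h
  · exact h
  · exact absurd h (not_le.2 h1')
  · exact absurd h (not_le.2 h2')
end

theorem homLinks (q : ℕ) (m : ℕ) : ∃ N, ∀ (A : ReducedHG) (ε : ℝ) (K : Fin q → Finset ℕ), Big N K →
    ∀ i j k : Fin q, i ≠ j → i ≠ k → j ≠ k → ∀ T U : ℕ → ℕ → ℕ,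
    ∃ K' ≤ K, Big m K' ∧ (Meet A ε K' i j T k U ∨ Miss A ε K' i j T k U) := by
  choose N hN using fun i => homPair q i (m + 1)
  refine ⟨Finset.univ.sup N, fun A ε K hK i j k hij hik hjk T U => ?_⟩
  let good : ℕ → ℕ → ℕ → ℕ → Prop := fun u u' b c => ε * ((A.P u u').card : ℝ) ≤
      (((A.nbhd u u' (T u b) (T u' b)) ∩ (A.nbhd u u' (U u c) (U u' c))).card : ℝ)
  have hgs : ∀ u u' b c, good u u' b c ↔ good u' u b c := by
    intro u u' b c
    simp only [good]
    rw [A.Psymm u u', nbhd_comm A u u', nbhd_comm A u u' (U u c)]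
  obtain ⟨K', hK', hB, c, hc⟩ := hN i K (hK.mono (Finset.le_sup (Finset.mem_univ i)))
    (fun a u u' => decide (good u u' (a j) (a k)))
  have key : ∀ u ∈ K' i, ∀ u' ∈ K' i, u ≠ u' → ∀ b ∈ K' j, ∀ d ∈ K' k, (good u u' b d ↔ c = true) := by
    have key0 : ∀ u ∈ K' i, ∀ u' ∈ K' i, u < u' → ∀ b ∈ K' j, ∀ d ∈ K' k, (good u u' b d ↔ c = true) := by
      intro u hu u' hu' hlt b hb d hd
      choose a0 ha0 using fun l => hB.nonempty (by omega) l
      have := hc (Function.update (Function.update a0 j b) k d) (by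
        rw [Fintype.mem_piFinset]
        intro l
        by_cases h1 : l = k
        · subst h1; simpa using hd
        by_cases h2 : l = j
        · subst h2; simpa [h1] using hb
        simpa [h1, h2] using ha0 l) u hu u' hu' hlt
      rw [← this]
      simp [hij.symm, hik.symm, hjk]
    intro u hu u' hu' hne b hb d hd
    rcases lt_or_gt_of_ne hne with h | h
    · exact key0 u hu u' hu' h b hb d hd
    · rw [hgs]; exact key0 u' hu' u hu h b hb d hd
  refine ⟨K', hK', hB.mono (by omega), ?_⟩
  cases hcc : c with
  | true => left; intro a ha a' ha' hne b hb d hd; exact (key a ha a' ha' hne b hb d hd).2 hcc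
  | false =>
    right; intro a ha a' ha' hne b hb d hd
    exact not_le.1 fun h => by
      have := (key a ha a' ha' hne b hb d hd).1 h
      simp [hcc] at this

structure Req (q : ℕ) where
  i : Fin q
  j : Fin q
  T : ℕ → ℕ → ℕ
  k : Fin q
  U : ℕ → ℕ → ℕ

def Req.Hom (A : ReducedHG) (ε : ℝ) (K : Fin q → Finset ℕ) (r : Req q) : Prop :=
  r.i ≠ r.j → r.i ≠ r.k → r.j ≠ r.k → (Meet A ε K r.i r.j r.T r.k r.U ∨ Miss A ε K r.i r.j r.T r.k r.U)

theorem homAll (q : ℕ) (n m : ℕ) : ∃ N, ∀ (A : ReducedHG) (ε : ℝ) (K : Fin q → Finset ℕ), Big N K →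
    ∀ L : List (Req q), L.length = n → ∃ K' ≤ K, Big m K' ∧ ∀ r ∈ L, r.Hom A ε K' := by
  induction n with
  | zero =>
    refine ⟨m, fun A ε K hK L hL => ⟨K, le_rfl, hK, ?_⟩⟩
    rw [List.length_eq_zero_iff] at hL; subst hL; simp
  | succ n ih =>
    obtain ⟨N, hN⟩ := ih
    obtain ⟨N', hN'⟩ := homLinks q N
    refine ⟨max N' N, fun A ε K hK L hL => ?_⟩
    cases L with
    | nil => simp at hL
    | cons r L =>
      have hL' : L.length = n := by simpa using hL
      by_cases hd : r.i ≠ r.j ∧ r.i ≠ r.k ∧ r.j ≠ r.k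
      · obtain ⟨K1, hK1, hB1, h1⟩ := hN' A ε K (hK.mono (le_max_left _ _)) r.i r.j r.k hd.1 hd.2.1 hd.2.2 r.T r.U
        obtain ⟨K2, hK2, hB2, h2⟩ := hN A ε K1 hB1 L hL'
        refine ⟨K2, hK2.trans hK1, hB2, ?_⟩
        intro r' hr'
        rcases List.mem_cons.1 hr' with rfl | hr'
        · intro _ _ _
          exact h1.imp (fun h => h.mono hK2) (fun h => h.mono hK2)
        · exact h2 r' hr'
      · obtain ⟨K2, hK2, hB2, h2⟩ := hN A ε K (hK.mono (le_max_right _ _)) L hL'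
        refine ⟨K2, hK2, hB2, ?_⟩
        intro r' hr'
        rcases List.mem_cons.1 hr' with rfl | hr'
        · intro h1 h2 h3; exact absurd ⟨h1, h2, h3⟩ hd
        · exact h2 r' hr'

theorem k5crit (A : ReducedHG) (e : Fin 5 → ℕ) (he : Function.Injective e) (heI : ∀ i, e i ∈ A.I)
    (g : Fin 5 → Fin 5 → ℕ) (hg : ∀ i j, i < j → g i j ∈ A.P (e i) (e j))
    (hE : ∀ i j k, i < j → j < k → A.Edge (g i j) (g i k) (g j k)) : A.SupportsK5 := by
  let g' : Fin 5 → Fin 5 → ℕ := fun i j => if i < j then g i j else g j i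
  have hs : ∀ i j, g' i j = g' j i := by
    intro i j
    simp only [g']
    rcases lt_trichotomy i j with h | h | h
    · rw [if_pos h, if_neg h.not_gt]
    · subst h; rfl
    · rw [if_neg h.not_gt, if_pos h]
  have hlt : ∀ {i j}, i < j → g' i j = g i j := fun h => if_pos h
  have hgt : ∀ {i j}, j < i → g' i j = g j i := fun h => if_neg h.not_gt
  refine ⟨Finset.univ.image e, ?_, ?_, fun x y => g' (Function.invFun e x) (Function.invFun e y), ?_, ?_, ?_⟩
  · intro x hx; obtain ⟨i, -, rfl⟩ := Finset.mem_image.1 hx; exact heI i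
  · rw [Finset.card_image_of_injective _ he]; simp
  · intro _ _ _ _; exact hs _ _
  · intro x hx y hy hxy
    obtain ⟨i, -, rfl⟩ := Finset.mem_image.1 hx
    obtain ⟨j, -, rfl⟩ := Finset.mem_image.1 hy
    have hij : i ≠ j := fun h => hxy (by rw [h])
    simp only [Function.leftInverse_invFun he _]
    rcases lt_or_gt_of_ne hij with h | h
    · rw [hlt h]; exact hg i j h
    · rw [hgt h, A.Psymm]; exact hg j i h
  · intro x hx y hy z hz hxy hxz hyz
    obtain ⟨i, -, rfl⟩ := Finset.mem_image.1 hx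
    obtain ⟨j, -, rfl⟩ := Finset.mem_image.1 hy
    obtain ⟨k, -, rfl⟩ := Finset.mem_image.1 hz
    have hij : i ≠ j := fun h => hxy (by rw [h])
    have hik : i ≠ k := fun h => hxz (by rw [h])
    have hjk : j ≠ k := fun h => hyz (by rw [h])
    simp only [Function.leftInverse_invFun he _]
    rcases lt_or_gt_of_ne hij with h1 | h1 <;> rcases lt_or_gt_of_ne hik with h2 | h2 <;>
      rcases lt_or_gt_of_ne hjk with h3 | h3
    · rw [hlt h1, hlt h2, hlt h3]; exact hE i j k h1 h3
    · rw [hlt h1, hlt h2, hgt h3]; exact A.EdgeSymm _ _ _ (hE i k j h2 h3)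
    · exact absurd (h1.trans h3) h2.not_gt
    · rw [hlt h1, hgt h2, hgt h3]
      exact A.EdgeSymm _ _ _ (A.EdgeSymm' _ _ _ (hE k i j h2 h1))
    · rw [hgt h1, hlt h2, hlt h3]; exact A.EdgeSymm' _ _ _ (hE j i k h1 h2)
    · exact absurd (h2.trans h3) h1.not_gt
    · rw [hgt h1, hgt h2, hlt h3]; exact A.EdgeSymm' _ _ _ (A.EdgeSymm _ _ _ (hE j k i h3 h2))
    · rw [hgt h1, hgt h2, hgt h3]
      exact A.EdgeSymm _ _ _ (A.EdgeSymm' _ _ _ (A.EdgeSymm _ _ _ (hE k j i h3 h1)))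

theorem kill (ε : ℝ) (hε : 0 < ε) (q : ℕ) : ∃ N, ∀ (A : ReducedHG), ¬ A.SupportsK5 →
    ∀ (K : Fin q → Finset ℕ), Sys A K → Big N K → ∀ i j k : Fin q, i ≠ j → i ≠ k → j ≠ k →
    ∀ T U W : ℕ → ℕ → ℕ, Tr A T → Tr A U → Tr A W →
    (∀ a ∈ K i, ∀ b ∈ K j, ∀ c ∈ K k, A.Edge (T a b) (U a c) (W b c)) →
    Meet A ε K i j T k U → Meet A ε K j i T k W → False := by
  obtain ⟨m0', hm0'⟩ := exists_nat_gt (1 / ε)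
  obtain ⟨m0, hm2, hm0⟩ : ∃ m0 : ℕ, 2 ≤ m0 ∧ 1 < ε * m0 := by
    refine ⟨m0' + 2, by omega, ?_⟩
    rw [div_lt_iff₀ hε] at hm0'
    push_cast; nlinarith
  have : Nonempty (Fin m0 × Fin m0) := ⟨⟨⟨0, by omega⟩, ⟨0, by omega⟩⟩⟩
  obtain ⟨N, hN⟩ := ramsey (Fin m0 × Fin m0) m0
  refine ⟨max N m0, fun A hA K hK hB i j k hij hik hjk T U W hT hU hW hE hM1 hM2 => hA ?_⟩
  obtain ⟨c, hc⟩ := hB.nonempty (by have := le_max_right N m0; omega) k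
  obtain ⟨A0, hA0, hA0c⟩ := Finset.exists_subset_card_eq ((le_max_right _ _).trans (hB i))
  let e := A0.orderEmbOfFin hA0c
  have heA : ∀ s, e s ∈ K i := fun s => hA0 (A0.orderEmbOfFin_mem hA0c s)
  have hex : ∀ b ∈ K j, ∀ b' ∈ K j, b ≠ b' → ∃ s : Fin m0 × Fin m0, s.1 ≠ s.2 ∧ ∃ y,
      y ∈ A.nbhd b b' (T b (e s.1)) (T b' (e s.1)) ∧ y ∈ A.nbhd b b' (T b (e s.2)) (T b' (e s.2)) ∧
      y ∈ A.nbhd b b' (W b c) (W b' c) := by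
    intro b hb b' hb' hne
    obtain ⟨s, -, s', -, hss, y, hy, hy'⟩ := two_meet ε (Finset.univ : Finset (Fin m0)) (A.P b b')
      (A.Pnonempty b b' (hK.sub j hb) (hK.sub j hb') hne)
      (fun s => A.nbhd b b' (T b (e s)) (T b' (e s)) ∩ A.nbhd b b' (W b c) (W b' c))
      (fun s _ => Finset.inter_subset_left.trans (nbhd_sub _ _ _ _ _))
      (fun s _ => hM2 b hb b' hb' hne _ (heA s) c hc) (by simpa using hm0)
    rw [Finset.mem_inter] at hy hy'
    exact ⟨⟨s, s'⟩, hss, y, hy.1, hy'.1, hy.2⟩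
  choose! χ hχ1 r hr using hex
  obtain ⟨B0, hB0, hB0c, s, hs⟩ := hN (K j) ((le_max_left _ _).trans (hB j)) χ
  have hsne : s.1 ≠ s.2 := by
    obtain ⟨b, hb, b', hb', hlt⟩ := exists_two (s := B0) (by omega)
    rw [← hs b hb b' hb' hlt]
    exact hχ1 b (hB0 hb) b' (hB0 hb') hlt.ne
  set a := e s.1
  set a' := e s.2
  have ha : a ∈ K i := heA _
  have ha' : a' ∈ K i := heA _
  have haa : a ≠ a' := fun h => hsne (e.injective h)
  obtain ⟨b, hb, b', hb', hbb, p, hp, hp'⟩ : ∃ b ∈ B0, ∃ b' ∈ B0, b < b' ∧ ∃ p,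
      p ∈ A.nbhd a a' (T a b) (T a' b) ∩ A.nbhd a a' (U a c) (U a' c) ∧
      p ∈ A.nbhd a a' (T a b') (T a' b') ∩ A.nbhd a a' (U a c) (U a' c) := by
    obtain ⟨b, hb, b', hb', hne, p, hp, hp'⟩ := two_meet ε B0 (A.P a a')
      (A.Pnonempty a a' (hK.sub i ha) (hK.sub i ha') haa)
      (fun b => A.nbhd a a' (T a b) (T a' b) ∩ A.nbhd a a' (U a c) (U a' c))
      (fun s _ => Finset.inter_subset_left.trans (nbhd_sub _ _ _ _ _))
      (fun b hb => hM1 a ha a' ha' haa b (hB0 hb) c hc) (by rw [hB0c]; exact hm0)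
    rcases lt_or_gt_of_ne hne with h | h
    · exact ⟨b, hb, b', hb', h, p, hp, hp'⟩
    · exact ⟨b', hb', b, hb, h, p, hp', hp⟩
  have hr' := hr b (hB0 hb) b' (hB0 hb') hbb.ne
  rw [hs b hb b' hb' hbb] at hr'
  have hbj := hB0 hb
  have hbj' := hB0 hb'
  rw [Finset.mem_inter, mem_nbhd, mem_nbhd] at hp hp'
  rw [mem_nbhd, mem_nbhd, mem_nbhd, hT.symm b, hT.symm b', hT.symm b, hT.symm b'] at hr'
  obtain ⟨⟨hpP, p1⟩, -, p2⟩ := hp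
  obtain ⟨⟨-, p3⟩, -, -⟩ := hp'
  obtain ⟨⟨hrP, r1⟩, ⟨-, r2⟩, -, r3⟩ := hr'
  have I1 := hK.sub i ha
  have I2 := hK.sub i ha'
  have I3 := hK.sub j hbj
  have I4 := hK.sub j hbj'
  have I5 := hK.sub k hc
  have n1 := hK.ne ha hbj hij
  have n2 := hK.ne ha hbj' hij
  have n3 := hK.ne ha hc hik
  have n4 := hK.ne ha' hbj hij
  have n5 := hK.ne ha' hbj' hij
  have n6 := hK.ne ha' hc hik
  have n7 := hK.ne hbj hc hjk
  have n8 := hK.ne hbj' hc hjk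
  have n9 := hbb.ne
  refine k5crit A ![a, a', b, b', c] ?_ ?_ ![![0, p, T a b, T a b', U a c], ![0, 0, T a' b, T a' b', U a' c],
    ![0, 0, 0, r b b', W b c], ![0, 0, 0, 0, W b' c], ![0, 0, 0, 0, 0]] ?_ ?_
  · have hnd : [a, a', b, b', c].Nodup := by simp [haa, n1, n2, n3, n4, n5, n6, n7, n8, n9]
    exact List.nodup_ofFn.1 (by simpa [List.ofFn_succ] using hnd)
  · intro i; fin_cases i <;> simp [I1, I2, I3, I4, I5]
  · intro i j hlt
    fin_cases i <;> fin_cases j <;> first | (exact absurd hlt (by decide)) | skip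
    · exact hpP
    · exact hT.mem _ I1 _ I3 n1
    · exact hT.mem _ I1 _ I4 n2
    · exact hU.mem _ I1 _ I5 n3
    · exact hT.mem _ I2 _ I3 n4
    · exact hT.mem _ I2 _ I4 n5
    · exact hU.mem _ I2 _ I5 n6
    · exact hrP
    · exact hW.mem _ I3 _ I5 n7
    · exact hW.mem _ I4 _ I5 n8
  · have rot : ∀ x y z, A.Edge x y z → A.Edge z x y := fun x y z h => A.EdgeSymm _ _ _ (A.EdgeSymm' _ _ _ h)
    intro i j k hlt hlt'
    fin_cases i <;> fin_cases j <;> (first | (exact absurd hlt (by decide)) | skip) <;> fin_cases k <;>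
      first | (exact absurd hlt' (by decide)) | skip
    · exact rot _ _ _ p1
    · exact rot _ _ _ p3
    · exact rot _ _ _ p2
    · exact r1
    · exact hE a ha b hbj c hc
    · exact hE a ha b' hbj' c hc
    · exact r2
    · exact hE a' ha' b hbj c hc
    · exact hE a' ha' b' hbj' c hc
    · exact rot _ _ _ r3
end

section
variable {q : ℕ}

theorem popNum (ε : ℝ) (hε : 0 < ε) (n m : ℕ) : ∃ N : ℕ, ∀ x y : ℕ, N ≤ x → ε ^ n * (x:ℝ) ≤ (y:ℝ) → m ≤ y := by
  obtain ⟨N, hN⟩ := exists_nat_ge ((m:ℝ) / ε ^ n)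
  refine ⟨N, fun x y hx hxy => ?_⟩
  have hp : 0 < ε ^ n := by positivity
  rw [div_le_iff₀ hp] at hN
  have : (N:ℝ) ≤ x := by exact_mod_cast hx
  have : (m:ℝ) ≤ y := by nlinarith
  exact_mod_cast this

theorem popBlock (ε : ℝ) (hε : 0 < ε) (M m : ℕ) : ∃ N, ∀ (A : ReducedHG) (B C : Finset ℕ), B ⊆ A.I → C ⊆ A.I →
    Disjoint B C → B.card = M → C.card = M → ∀ (X : Finset ℕ), N ≤ X.card →
    ∀ G : ℕ → ℕ → ℕ → Finset ℕ, (∀ b ∈ B, ∀ c ∈ C, ∀ x ∈ X, G b c x ⊆ A.P b c ∧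
      ε * ((A.P b c).card : ℝ) ≤ ((G b c x).card : ℝ)) →
    ∃ X' ⊆ X, m ≤ X'.card ∧ ∃ V, Tr A V ∧ ∀ b ∈ B, ∀ c ∈ C, ∀ x ∈ X', V b c ∈ G b c x := by
  obtain ⟨N, hN⟩ := popNum ε hε (M * M) m
  refine ⟨N, fun A B C hB hC hd hBc hCc X hX G hG => ?_⟩
  have hne : ∀ b ∈ B, ∀ c ∈ C, b ≠ c := fun b hb c hc e => Finset.disjoint_left.1 hd hb (e ▸ hc)
  obtain ⟨X', hX', hc, Y, hY⟩ := pop_core ε hε (B ×ˢ C) X (fun p => A.P p.1 p.2) (fun p x => G p.1 p.2 x)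
    (fun p hp x hx => (hG _ (Finset.mem_product.1 hp).1 _ (Finset.mem_product.1 hp).2 x hx).1)
    (fun p hp => A.Pnonempty _ _ (hB (Finset.mem_product.1 hp).1) (hC (Finset.mem_product.1 hp).2)
      (hne _ (Finset.mem_product.1 hp).1 _ (Finset.mem_product.1 hp).2))
    (fun p hp x hx => (hG _ (Finset.mem_product.1 hp).1 _ (Finset.mem_product.1 hp).2 x hx).2)
  rw [Finset.card_product, hBc, hCc] at hc
  obtain ⟨F, hF⟩ := exists_Tr A
  let V : ℕ → ℕ → ℕ := fun b c => if b ∈ B ∧ c ∈ C then Y (b, c) else if c ∈ B ∧ b ∈ C then Y (c, b) else F b c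
  have hno : ∀ x, x ∈ B → x ∈ C → False := fun x h1 h2 => Finset.disjoint_left.1 hd h1 h2
  refine ⟨X', hX', hN _ _ hX hc, V, ⟨?_, ?_⟩, ?_⟩
  · intro b c
    simp only [V]
    by_cases h1 : b ∈ B ∧ c ∈ C
    · have h2 : ¬ (c ∈ B ∧ b ∈ C) := fun h => hno b h1.1 h.2
      rw [if_pos h1, if_neg h2, if_pos h1]
    · by_cases h2 : c ∈ B ∧ b ∈ C
      · rw [if_neg h1, if_pos h2, if_pos h2]
      · rw [if_neg h1, if_neg h2, if_neg h2, if_neg h1, hF.symm]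
  · intro b hb c hc hbc
    simp only [V]
    split_ifs with h1 h2
    · exact (hY (b, c) (Finset.mem_product.2 h1)).1
    · rw [A.Psymm]; exact (hY (c, b) (Finset.mem_product.2 h2)).1
    · exact hF.mem b hb c hc hbc
  · intro b hb c hc x hx
    have : V b c = Y (b, c) := if_pos ⟨hb, hc⟩
    rw [this]
    exact (hY (b, c) (Finset.mem_product.2 ⟨hb, hc⟩)).2 x hx

theorem popSym (ε : ℝ) (hε : 0 < ε) (M m : ℕ) : ∃ N, ∀ (A : ReducedHG) (B : Finset ℕ), B ⊆ A.I →
    B.card = M → ∀ (X : Finset ℕ), N ≤ X.card →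
    ∀ G : ℕ → ℕ → ℕ → Finset ℕ, (∀ b c x, G b c x = G c b x) →
    (∀ b ∈ B, ∀ c ∈ B, b ≠ c → ∀ x ∈ X, G b c x ⊆ A.P b c ∧
      ε * ((A.P b c).card : ℝ) ≤ ((G b c x).card : ℝ)) →
    ∃ X' ⊆ X, m ≤ X'.card ∧ ∃ V, Tr A V ∧ ∀ b ∈ B, ∀ c ∈ B, b ≠ c → ∀ x ∈ X', V b c ∈ G b c x := by
  obtain ⟨N, hN⟩ := popNum ε hε (M * M - M) m
  refine ⟨N, fun A B hB hBc X hX G hGs hG => ?_⟩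
  obtain ⟨X', hX', hc, Y, hY⟩ := pop_core ε hε B.offDiag X (fun p => A.P p.1 p.2) (fun p x => G p.1 p.2 x)
    (fun p hp x hx => by
      obtain ⟨h1, h2, h3⟩ := Finset.mem_offDiag.1 hp
      exact (hG _ h1 _ h2 h3 x hx).1)
    (fun p hp => by
      obtain ⟨h1, h2, h3⟩ := Finset.mem_offDiag.1 hp
      exact A.Pnonempty _ _ (hB h1) (hB h2) h3)
    (fun p hp x hx => by
      obtain ⟨h1, h2, h3⟩ := Finset.mem_offDiag.1 hp
      exact (hG _ h1 _ h2 h3 x hx).2)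
  rw [Finset.offDiag_card, hBc] at hc
  obtain ⟨F, hF⟩ := exists_Tr A
  let V : ℕ → ℕ → ℕ := fun b c => if b ∈ B ∧ c ∈ B then Y (min b c, max b c) else F b c
  have hmm : ∀ b ∈ B, ∀ c ∈ B, b ≠ c → (min b c, max b c) ∈ B.offDiag ∧
      ((min b c = b ∧ max b c = c) ∨ (min b c = c ∧ max b c = b)) := by
    intro b hb c hc hbc
    rcases lt_or_gt_of_ne hbc with h | h
    · rw [min_eq_left h.le, max_eq_right h.le]
      exact ⟨Finset.mem_offDiag.2 ⟨hb, hc, hbc⟩, Or.inl ⟨rfl, rfl⟩⟩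
    · rw [min_eq_right h.le, max_eq_left h.le]
      exact ⟨Finset.mem_offDiag.2 ⟨hc, hb, hbc.symm⟩, Or.inr ⟨rfl, rfl⟩⟩
  refine ⟨X', hX', hN _ _ hX hc, V, ⟨?_, ?_⟩, ?_⟩
  · intro b c
    simp only [V]
    rw [min_comm, max_comm, hF.symm]
    by_cases h1 : b ∈ B <;> by_cases h2 : c ∈ B <;> simp [h1, h2]
  · intro b hb c hc hbc
    simp only [V]
    split_ifs with h1
    · obtain ⟨h2, h3⟩ := hmm b h1.1 c h1.2 hbc
      have := (hY _ h2).1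
      rcases h3 with ⟨h3, h4⟩ | ⟨h3, h4⟩
      · simpa only [h3, h4] using this
      · rw [A.Psymm]; simpa only [h3, h4] using this
    · exact hF.mem b hb c hc hbc
  · intro b hb c hc hbc x hx
    have : V b c = Y (min b c, max b c) := if_pos ⟨hb, hc⟩
    rw [this]
    obtain ⟨h2, h3⟩ := hmm b hb c hc hbc
    have := (hY _ h2).2 x hx
    rcases h3 with ⟨h3, h4⟩ | ⟨h3, h4⟩
    · simpa only [h3, h4] using this
    · rw [hGs]; simpa only [h3, h4] using this

/-- replace three blocks -/
theorem create (ε : ℝ) (hε : 0 < ε) (q m : ℕ) : ∃ N, ∀ (A : ReducedHG), A.Wicked ε →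
    ∀ (K : Fin q → Finset ℕ), Sys A K → Big N K → ∀ i j k : Fin q, i ≠ j → i ≠ k → j ≠ k →
    ∀ T U : ℕ → ℕ → ℕ, Tr A T → Tr A U → Meet A ε K i j T k U →
    ∃ K' ≤ K, Big m K' ∧ ∃ V, Tr A V ∧
      (∀ a ∈ K' i, ∀ b ∈ K' j, ∀ c ∈ K' k, A.Edge (T a b) (U a c) (V b c)) ∧
      Miss A ε K' j k V i T ∧ Miss A ε K' k j V i U := by
  obtain ⟨N1, h1⟩ := kill ε hε q
  obtain ⟨N2, h2⟩ := homAll q 2 (max m N1)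
  obtain ⟨N3, h3⟩ := popBlock ε hε N2 N2
  refine ⟨max N2 N3, fun A hA K hK hB i j k hij hik hjk T U hT hU hM => ?_⟩
  obtain ⟨K0, hK0, hK0c⟩ := trim (K := K) (fun _ => N2) (fun l => (le_max_left _ _).trans (hB l))
  have hKs := hK.mono hK0
  obtain ⟨X', hX', hXc, V, hV, hVE⟩ := h3 A (K0 j) (K0 k) (hKs.sub j) (hKs.sub k) (hKs.disj j k hjk) (hK0c j)
    (hK0c k) (K i) ((le_max_right _ _).trans (hB i)) (fun b c a => A.nbhd b c (T a b) (U a c)) (by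
      intro b hb c hc a ha
      refine ⟨nbhd_sub _ _ _ _ _, ?_⟩
      have n1 := hK.ne ha (hK0 j hb) hij
      have n2 := hK.ne ha (hK0 k hc) hik
      have := hA.1 a b c (hK.sub i ha) (hKs.sub j hb) (hKs.sub k hc) n1 n2 (hKs.ne hb hc hjk)
        (T a b) (hT.mem a (hK.sub i ha) b (hKs.sub j hb) n1)
        (U a c) (hU.mem a (hK.sub i ha) c (hKs.sub k hc) n2)
      have hp : (0:ℝ) ≤ (A.P b c).card := by positivity
      nlinarith)
  have hK1 : Function.update K0 i X' ≤ K := by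
    intro l
    by_cases h : l = i
    · subst h; simpa using hX'
    · simpa [h] using hK0 l
  obtain ⟨K', hK', hB', hL⟩ := h2 A ε (Function.update K0 i X') (by
    intro l
    by_cases h : l = i
    · subst h; simpa using hXc
    · simp [h, hK0c]) [⟨j, k, V, i, T⟩, ⟨k, j, V, i, U⟩] rfl
  have hKK := hK'.trans hK1
  have hS := hK.mono hKK
  have hE : ∀ a ∈ K' i, ∀ b ∈ K' j, ∀ c ∈ K' k, A.Edge (T a b) (U a c) (V b c) := by
    intro a ha b hb c hc
    have ha' := hK' i ha
    have hb' := hK' j hb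
    have hc' := hK' k hc
    simp [hij.symm, hik.symm] at ha' hb' hc'
    exact (mem_nbhd.1 (hVE b hb' c hc' a ha')).2
  have hbN := hB'.mono (le_max_right _ _)
  refine ⟨K', hKK, hB'.mono (le_max_left _ _), V, hV, hE, ?_, ?_⟩
  · rcases hL ⟨j, k, V, i, T⟩ (by simp) hjk hij.symm hik.symm with h | h
    · exact (h1 A hA.2 K' hS hbN i j k hij hik hjk T U V hT hU hV hE (hM.mono hKK) h.symm).elim
    · exact h
  · rcases hL ⟨k, j, V, i, U⟩ (by simp) hjk.symm hik.symm hij.symm with h | h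
    · refine (h1 A hA.2 K' hS hbN i k j hik hij hjk.symm U T V hU hT hV ?_ (hM.mono hKK).symm h.symm).elim
      intro a ha c hc b hb
      rw [hV.symm c b]
      exact A.EdgeSymm _ _ _ (hE a ha b hb c hc)
    · exact h

theorem duo1 (ε : ℝ) (hε : 0 < ε) (q : ℕ) : ∃ N, ∀ (A : ReducedHG), A.Wicked ε →
    ∀ (K : Fin q → Finset ℕ), Sys A K → Big N K → ∀ a₁ a₂ b c : Fin q, a₁ ≠ a₂ → a₁ ≠ b → a₁ ≠ c →
    a₂ ≠ b → a₂ ≠ c → b ≠ c →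
    ∀ T₁ U₁ T₂ U₂ : ℕ → ℕ → ℕ, Tr A T₁ → Tr A U₁ → Tr A T₂ → Tr A U₂ →
    Meet A ε K a₁ b T₁ c U₁ → Meet A ε K a₂ b T₂ c U₂ →
    (∀ u₁ ∈ K a₁, ∀ u₂ ∈ K a₂, ∀ v ∈ K b, ∀ w ∈ K c, ε * ((A.P v w).card : ℝ) ≤
      ((A.nbhd v w (T₁ u₁ v) (U₁ u₁ w) ∩ A.nbhd v w (T₂ u₂ v) (U₂ u₂ w)).card : ℝ)) →
    Miss A ε K b a₁ T₁ a₂ T₂ → False := by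
  obtain ⟨N1, h1⟩ := kill ε hε q
  obtain ⟨N2, h2⟩ := homLinks q (N1 + 1)
  obtain ⟨N3, h3⟩ := popBlock ε hε N2 N2
  refine ⟨max N2 N3, fun A hA K hK hB a₁ a₂ b c h12 h1b h1c h2b h2c hbc T₁ U₁ T₂ U₂ hT₁ hU₁ hT₂ hU₂ hM₁ hM₂ hI hms => ?_⟩
  obtain ⟨K0, hK0, hK0c⟩ := trim (K := K) (fun _ => N2) (fun l => (le_max_left _ _).trans (hB l))
  have hKs := hK.mono hK0
  have inj : ∀ l, ∃ g : ℕ → ℕ, (∀ x ∈ Finset.range N3, g x ∈ K l) ∧ Set.InjOn g (Finset.range N3) := by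
    intro l
    obtain ⟨S, hS, hSc⟩ := Finset.exists_subset_card_eq ((le_max_right _ _).trans (hB l))
    refine ⟨fun x => if h : x < N3 then S.orderEmbOfFin hSc ⟨x, h⟩ else 0, ?_, ?_⟩
    · intro x hx
      have h := Finset.mem_range.1 hx
      simp only [h, dif_pos]
      exact hS (S.orderEmbOfFin_mem hSc _)
    · intro x hx y hy hxy
      have h := Finset.mem_range.1 (Finset.mem_coe.1 hx)
      have h' := Finset.mem_range.1 (Finset.mem_coe.1 hy)
      simp only [h, h', dif_pos] at hxy
      simpa using (S.orderEmbOfFin hSc).injective hxy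
  obtain ⟨g₁, hg₁, hi₁⟩ := inj a₁
  obtain ⟨g₂, hg₂, hi₂⟩ := inj a₂
  obtain ⟨X', hX', hXc, V, hV, hVE⟩ := h3 A (K0 b) (K0 c) (hKs.sub b) (hKs.sub c) (hKs.disj b c hbc) (hK0c b)
    (hK0c c) (Finset.range N3) (by simp) (fun v w x => A.nbhd v w (T₁ (g₁ x) v) (U₁ (g₁ x) w) ∩
      A.nbhd v w (T₂ (g₂ x) v) (U₂ (g₂ x) w)) (by
      intro v hv w hw x hx
      exact ⟨Finset.inter_subset_left.trans (nbhd_sub _ _ _ _ _),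
        hI _ (hg₁ x hx) _ (hg₂ x hx) v (hK0 b hv) w (hK0 c hw)⟩)
  set K1 := Function.update (Function.update K0 a₁ (X'.image g₁)) a₂ (X'.image g₂) with hK1d
  have e1 : K1 a₁ = X'.image g₁ := by simp [hK1d, h12]
  have e2 : K1 a₂ = X'.image g₂ := by simp [hK1d]
  have e3 : ∀ l, l ≠ a₁ → l ≠ a₂ → K1 l = K0 l := by intro l h h'; simp [hK1d, h, h']
  have hK1 : K1 ≤ K := by
    intro l
    by_cases h : l = a₁
    · subst h; rw [e1]; intro y hy; obtain ⟨x, hx, rfl⟩ := Finset.mem_image.1 hy; exact hg₁ x (hX' hx)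
    by_cases h' : l = a₂
    · subst h'; rw [e2]; intro y hy; obtain ⟨x, hx, rfl⟩ := Finset.mem_image.1 hy; exact hg₂ x (hX' hx)
    rw [e3 l h h']; exact hK0 l
  obtain ⟨K', hK', hB', hL⟩ := h2 A ε K1 (by
    intro l
    by_cases h : l = a₁
    · subst h; rw [e1, Finset.card_image_of_injOn (hi₁.mono (by exact_mod_cast hX'))]; exact hXc
    by_cases h' : l = a₂
    · subst h'; rw [e2, Finset.card_image_of_injOn (hi₂.mono (by exact_mod_cast hX'))]; exact hXc
    rw [e3 l h h', hK0c]) b c a₁ hbc h1b.symm h1c.symm V T₁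
  have hKK := hK'.trans hK1
  have hS := hK.mono hKK
  have hbN := hB'.mono (Nat.le_succ _)
  have hE₁ : ∀ u ∈ K' a₁, ∀ v ∈ K' b, ∀ w ∈ K' c, A.Edge (T₁ u v) (U₁ u w) (V v w) := by
    intro u hu v hv w hw
    have hu' := hK' _ hu
    have hv' := hK' _ hv
    have hw' := hK' _ hw
    rw [e1] at hu'
    rw [e3 b h1b.symm h2b.symm] at hv'
    rw [e3 c h1c.symm h2c.symm] at hw'
    obtain ⟨x, hx, rfl⟩ := Finset.mem_image.1 hu'
    exact (mem_nbhd.1 (Finset.mem_inter.1 (hVE v hv' w hw' x hx)).1).2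
  have hE₂ : ∀ u ∈ K' a₂, ∀ v ∈ K' b, ∀ w ∈ K' c, A.Edge (T₂ u v) (U₂ u w) (V v w) := by
    intro u hu v hv w hw
    have hu' := hK' _ hu
    have hv' := hK' _ hv
    have hw' := hK' _ hw
    rw [e2] at hu'
    rw [e3 b h1b.symm h2b.symm] at hv'
    rw [e3 c h1c.symm h2c.symm] at hw'
    obtain ⟨x, hx, rfl⟩ := Finset.mem_image.1 hu'
    exact (mem_nbhd.1 (Finset.mem_inter.1 (hVE v hv' w hw' x hx)).2).2
  rcases hL with h | h
  · exact h1 A hA.2 K' hS hbN a₁ b c h1b h1c hbc T₁ U₁ V hT₁ hU₁ hV hE₁ (hM₁.mono hKK) h.symm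
  · have := meet_of_miss hA.1 hS hV hT₂ hT₁ hbc h2b.symm h1b.symm (hB'.nonempty (by omega) a₁) h (hms.mono hKK).symm
    exact h1 A hA.2 K' hS hbN a₂ b c h2b h2c hbc T₂ U₂ V hT₂ hU₂ hV hE₂ (hM₂.mono hKK) this.symm

def Ds (A : ReducedHG) (ε : ℝ) (K : Fin q → Finset ℕ) (b c a₁ : Fin q) (T₁ U₁ : ℕ → ℕ → ℕ) (a₂ : Fin q)
    (T₂ U₂ : ℕ → ℕ → ℕ) : Prop := Miss A ε K b a₁ T₁ a₂ T₂ ∨ Miss A ε K c a₁ U₁ a₂ U₂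

theorem duo (ε : ℝ) (hε : 0 < ε) (q : ℕ) : ∃ N, ∀ (A : ReducedHG), A.Wicked ε →
    ∀ (K : Fin q → Finset ℕ), Sys A K → Big N K → ∀ a₁ a₂ b c : Fin q, a₁ ≠ a₂ → a₁ ≠ b → a₁ ≠ c →
    a₂ ≠ b → a₂ ≠ c → b ≠ c →
    ∀ T₁ U₁ T₂ U₂ : ℕ → ℕ → ℕ, Tr A T₁ → Tr A U₁ → Tr A T₂ → Tr A U₂ →
    Meet A ε K a₁ b T₁ c U₁ → Meet A ε K a₂ b T₂ c U₂ →
    (∀ u₁ ∈ K a₁, ∀ u₂ ∈ K a₂, ∀ v ∈ K b, ∀ w ∈ K c, ε * ((A.P v w).card : ℝ) ≤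
      ((A.nbhd v w (T₁ u₁ v) (U₁ u₁ w) ∩ A.nbhd v w (T₂ u₂ v) (U₂ u₂ w)).card : ℝ)) →
    Ds A ε K b c a₁ T₁ U₁ a₂ T₂ U₂ → False := by
  obtain ⟨N, h⟩ := duo1 ε hε q
  refine ⟨N, fun A hA K hK hB a₁ a₂ b c h12 h1b h1c h2b h2c hbc T₁ U₁ T₂ U₂ hT₁ hU₁ hT₂ hU₂ hM₁ hM₂ hI hms => ?_⟩
  rcases hms with hms | hms
  · exact h A hA K hK hB a₁ a₂ b c h12 h1b h1c h2b h2c hbc T₁ U₁ T₂ U₂ hT₁ hU₁ hT₂ hU₂ hM₁ hM₂ hI hms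
  · refine h A hA K hK hB a₁ a₂ c b h12 h1c h1b h2c h2b hbc.symm U₁ T₁ U₂ T₂ hU₁ hT₁ hU₂ hT₂ hM₁.symm hM₂.symm ?_ hms
    intro u₁ hu₁ u₂ hu₂ v hv w hw
    have := hI u₁ hu₁ u₂ hu₂ w hw v hv
    rwa [A.Psymm, nbhd_comm A v w, nbhd_comm A v w (U₂ u₂ v)]

theorem upd_mem {K : Fin q → Finset ℕ} {a : Fin q → ℕ} (ha : a ∈ Fintype.piFinset K) {i : Fin q} {u : ℕ}
    (hu : u ∈ K i) : Function.update a i u ∈ Fintype.piFinset K := by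
  rw [Fintype.mem_piFinset] at ha ⊢
  intro l
  by_cases h : l = i
  · subst h; simpa using hu
  · simpa [h] using ha l

theorem triad (ε : ℝ) (hε : 0 < ε) (q : ℕ) : ∃ N, ∀ (A : ReducedHG), A.Wicked ε →
    ∀ (K : Fin q → Finset ℕ), Sys A K → Big N K → ∀ a₁ a₂ a₃ b c : Fin q, [a₁, a₂, a₃, b, c].Nodup →
    ∀ T₁ U₁ T₂ U₂ T₃ U₃ : ℕ → ℕ → ℕ, Tr A T₁ → Tr A U₁ → Tr A T₂ → Tr A U₂ → Tr A T₃ → Tr A U₃ →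
    Meet A ε K a₁ b T₁ c U₁ → Meet A ε K a₂ b T₂ c U₂ → Meet A ε K a₃ b T₃ c U₃ →
    Ds A ε K b c a₁ T₁ U₁ a₂ T₂ U₂ → Ds A ε K b c a₁ T₁ U₁ a₃ T₃ U₃ → Ds A ε K b c a₂ T₂ U₂ a₃ T₃ U₃ → False := by
  obtain ⟨N, h⟩ := duo ε hε q
  obtain ⟨N', h'⟩ := boxColor q (Fin 3) (N + 1)
  refine ⟨N', fun A hA K hK hB a₁ a₂ a₃ b c hnd T₁ U₁ T₂ U₂ T₃ U₃ hT₁ hU₁ hT₂ hU₂ hT₃ hU₃ hM₁ hM₂ hM₃ h12 h13 h23 => ?_⟩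
  simp only [List.nodup_cons, List.mem_cons, not_or, List.not_mem_nil, not_false_eq_true, and_true,
    List.nodup_nil] at hnd
  obtain ⟨⟨n12, n13, n1b, n1c⟩, ⟨n23, n2b, n2c⟩, ⟨n3b, n3c⟩, nbc⟩ := hnd
  let I : (ℕ → ℕ → ℕ) → (ℕ → ℕ → ℕ) → (ℕ → ℕ → ℕ) → (ℕ → ℕ → ℕ) → ℕ → ℕ → ℕ → ℕ → Prop :=
    fun T U T' U' u u' v w => ε * ((A.P v w).card : ℝ) ≤
      ((A.nbhd v w (T u v) (U u w) ∩ A.nbhd v w (T' u' v) (U' u' w)).card : ℝ)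
  have hdeg : ∀ a, a ≠ b → a ≠ c → ∀ T U, Tr A T → Tr A U → ∀ x ∈ Fintype.piFinset K,
      (1/3 + ε) * ((A.P (x b) (x c)).card : ℝ) ≤ ((A.nbhd (x b) (x c) (T (x a) (x b)) (U (x a) (x c))).card : ℝ) := by
    intro a hab hac T U hT hU x hx
    rw [Fintype.mem_piFinset] at hx
    exact hA.1 (x a) (x b) (x c) (hK.sub _ (hx a)) (hK.sub _ (hx b)) (hK.sub _ (hx c))
      (hK.ne (hx a) (hx b) hab) (hK.ne (hx a) (hx c) hac) (hK.ne (hx b) (hx c) nbc)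
      _ (hT.mem _ (hK.sub _ (hx a)) _ (hK.sub _ (hx b)) (hK.ne (hx a) (hx b) hab))
      _ (hU.mem _ (hK.sub _ (hx a)) _ (hK.sub _ (hx c)) (hK.ne (hx a) (hx c) hac))
  obtain ⟨K', hK', hB', s, hs⟩ := h' K hB (fun s x => ![I T₁ U₁ T₂ U₂ (x a₁) (x a₂) (x b) (x c),
    I T₁ U₁ T₃ U₃ (x a₁) (x a₃) (x b) (x c), I T₂ U₂ T₃ U₃ (x a₂) (x a₃) (x b) (x c)] s) (by
      intro x hx
      rcases three_sets ε (A.P (x b) (x c)) _ _ _ (nbhd_sub _ _ _ _ _) (nbhd_sub _ _ _ _ _) (nbhd_sub _ _ _ _ _)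
        (hdeg a₁ n1b n1c T₁ U₁ hT₁ hU₁ x hx) (hdeg a₂ n2b n2c T₂ U₂ hT₂ hU₂ x hx)
        (hdeg a₃ n3b n3c T₃ U₃ hT₃ hU₃ x hx) with h | h | h
      · exact ⟨0, h⟩
      · exact ⟨1, h⟩
      · exact ⟨2, h⟩)
  have hS := hK.mono hK'
  have hB1 := hB'.mono (Nat.le_succ _)
  choose x0 hx0 using fun l => hB'.nonempty (by omega) l
  have hx0' : x0 ∈ Fintype.piFinset K' := Fintype.mem_piFinset.2 hx0
  have ext : ∀ a a', a ≠ a' → a ≠ b → a ≠ c → a' ≠ b → a' ≠ c → ∀ u ∈ K' a, ∀ u' ∈ K' a', ∀ v ∈ K' b, ∀ w ∈ K' c,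
      ∃ x ∈ Fintype.piFinset K', x a = u ∧ x a' = u' ∧ x b = v ∧ x c = w := by
    intro a a' h1 h2 h3 h4 h5 u hu u' hu' v hv w hw
    refine ⟨_, upd_mem (upd_mem (upd_mem (upd_mem hx0' hu) hu') hv) hw, ?_, ?_, ?_, ?_⟩ <;>
      simp [h1, h2, h3, h4, h5, nbc]
  have mD : ∀ {a₁ T₁ U₁ a₂ T₂ U₂}, Ds A ε K b c a₁ T₁ U₁ a₂ T₂ U₂ → Ds A ε K' b c a₁ T₁ U₁ a₂ T₂ U₂ :=
    fun h => h.imp (fun h => h.mono hK') (fun h => h.mono hK')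
  fin_cases s
  · refine h A hA K' hS hB1 a₁ a₂ b c n12 n1b n1c n2b n2c nbc T₁ U₁ T₂ U₂ hT₁ hU₁ hT₂ hU₂ (hM₁.mono hK')
      (hM₂.mono hK') ?_ (mD h12)
    intro u hu u' hu' v hv w hw
    obtain ⟨x, hx, rfl, rfl, rfl, rfl⟩ := ext a₁ a₂ n12 n1b n1c n2b n2c u hu u' hu' v hv w hw
    exact hs x hx
  · refine h A hA K' hS hB1 a₁ a₃ b c n13 n1b n1c n3b n3c nbc T₁ U₁ T₃ U₃ hT₁ hU₁ hT₃ hU₃ (hM₁.mono hK')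
      (hM₃.mono hK') ?_ (mD h13)
    intro u hu u' hu' v hv w hw
    obtain ⟨x, hx, rfl, rfl, rfl, rfl⟩ := ext a₁ a₃ n13 n1b n1c n3b n3c u hu u' hu' v hv w hw
    exact hs x hx
  · refine h A hA K' hS hB1 a₂ a₃ b c n23 n2b n2c n3b n3c nbc T₂ U₂ T₃ U₃ hT₂ hU₂ hT₃ hU₃ (hM₂.mono hK')
      (hM₃.mono hK') ?_ (mD h23)
    intro u hu u' hu' v hv w hw
    obtain ⟨x, hx, rfl, rfl, rfl, rfl⟩ := ext a₂ a₃ n23 n2b n2c n3b n3c u hu u' hu' v hv w hw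
    exact hs x hx
end

section
variable {q : ℕ}

theorem partition (q n : ℕ) (V : Finset ℕ) (hV : q * n ≤ V.card) : ∃ K : Fin q → Finset ℕ,
    (∀ i, K i ⊆ V) ∧ (∀ i j, i ≠ j → Disjoint (K i) (K j)) ∧ ∀ i, (K i).card = n := by
  obtain ⟨S, hS, hSc⟩ := Finset.exists_subset_card_eq hV
  let e := S.orderEmbOfFin hSc
  refine ⟨fun i => Finset.univ.image fun x : Fin n => e (finProdFinEquiv (i, x)), ?_, ?_, ?_⟩
  · intro i y hy
    obtain ⟨x, -, rfl⟩ := Finset.mem_image.1 hy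
    exact hS (S.orderEmbOfFin_mem hSc _)
  · intro i j hij
    rw [Finset.disjoint_left]
    intro y hy hy'
    obtain ⟨x, -, rfl⟩ := Finset.mem_image.1 hy
    obtain ⟨x', -, h⟩ := Finset.mem_image.1 hy'
    have := finProdFinEquiv.injective (e.injective h)
    exact hij (Prod.ext_iff.1 this).1.symm
  · intro i
    rw [Finset.card_image_of_injective]
    · simp
    · intro x y h
      have := finProdFinEquiv.injective (e.injective h)
      exact (Prod.ext_iff.1 this).2

theorem pairpair (ε : ℝ) (n : ℕ) : ∃ N, ∀ (A : ReducedHG), A.Wicked ε → N ≤ A.I.card →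
    ∀ F, Tr A F → ∃ X ⊆ A.I, ∃ Y ⊆ A.I, Disjoint X Y ∧ n ≤ X.card ∧ n ≤ Y.card ∧
      ∀ x ∈ X, ∀ x' ∈ X, x ≠ x' → ∀ k ∈ Y, ∀ k' ∈ Y, k ≠ k' → ε * ((A.P x x').card : ℝ) ≤
      ((A.nbhd x x' (F x k) (F x' k) ∩ A.nbhd x x' (F x k') (F x' k')).card : ℝ) := by
  obtain ⟨r, hr⟩ := ramsey Bool (n + 3)
  obtain ⟨N1, h1⟩ := ramseyMulti Bool (r * r) (n + 2)
  refine ⟨r + N1, fun A hA hc F hF => ?_⟩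
  obtain ⟨Y0, hY0, hY0c⟩ := Finset.exists_subset_card_eq (show r ≤ A.I.card by omega)
  let good : ℕ → ℕ → ℕ → ℕ → Prop := fun k k' x x' => ε * ((A.P x x').card : ℝ) ≤
      ((A.nbhd x x' (F x k) (F x' k) ∩ A.nbhd x x' (F x k') (F x' k')).card : ℝ)
  have s1 : ∀ k k' x x', good k k' x x' ↔ good k' k x x' := by
    intro k k' x x'; simp only [good]; rw [Finset.inter_comm]
  have s2 : ∀ k k' x x', good k k' x x' ↔ good k k' x' x := by
    intro k k' x x'; simp only [good]; rw [A.Psymm, nbhd_comm A x x', nbhd_comm A x x' (F x k')]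
  obtain ⟨X, hX, hXc, c, hcc⟩ := h1 (ℕ × ℕ) (A.I \ Y0) (by rw [Finset.card_sdiff_of_subset hY0]; omega)
    (Y0 ×ˢ Y0) (by rw [Finset.card_product, hY0c]) (fun p x x' => decide (good p.1 p.2 x x'))
  obtain ⟨Y, hY, hYc, d, hd⟩ := hr Y0 hY0c.ge (fun k k' => c (k, k'))
  have key : ∀ x ∈ X, ∀ x' ∈ X, x < x' → ∀ k ∈ Y, ∀ k' ∈ Y, k < k' → (good k k' x x' ↔ d = true) := by
    intro x hx x' hx' hlt k hk k' hk' hkk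
    have e1 := hcc (k, k') (Finset.mem_product.2 ⟨hY hk, hY hk'⟩) x hx x' hx' hlt
    have e2 := hd k hk k' hk' hkk
    rw [← e2, ← e1]; simp
  have hXI : X ⊆ A.I := hX.trans Finset.sdiff_subset
  have hXY : Disjoint X Y := by
    rw [Finset.disjoint_left]; intro y hy hy'
    exact (Finset.mem_sdiff.1 (hX hy)).2 (hY hy')
  have hYI : Y ⊆ A.I := hY.trans hY0
  have hdt : d = true := by
    by_contra hdf
    obtain ⟨x, hx, x', hx', hlt⟩ := exists_two (s := X) (by omega)
    let e := Y.orderEmbOfFin hYc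
    have he : ∀ s, e s ∈ Y := Y.orderEmbOfFin_mem hYc
    have hne : ∀ s y, y ∈ X → y ≠ e s := fun s y hy h => Finset.disjoint_left.1 hXY hy (h ▸ he s)
    have l1 : e ⟨0, by omega⟩ < e ⟨1, by omega⟩ := e.strictMono (by simp [Fin.lt_def])
    have l2 : e ⟨1, by omega⟩ < e ⟨2, by omega⟩ := e.strictMono (by simp [Fin.lt_def])
    have lc : ∀ s, _ := fun s => link_card (ε := ε) hA.1 hF (hXI hx) (hXI hx') (hYI (he s)) hlt.ne (hne s x hx) (hne s x' hx')
    rcases three_sets ε (A.P x x') _ _ _ (nbhd_sub _ _ _ _ _) (nbhd_sub _ _ _ _ _) (nbhd_sub _ _ _ _ _)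
      (lc ⟨0, by omega⟩) (lc ⟨1, by omega⟩) (lc ⟨2, by omega⟩) with h | h | h
    · exact hdf ((key x hx x' hx' hlt _ (he _) _ (he _) l1).1 h)
    · exact hdf ((key x hx x' hx' hlt _ (he _) _ (he _) (l1.trans l2)).1 h)
    · exact hdf ((key x hx x' hx' hlt _ (he _) _ (he _) l2).1 h)
  refine ⟨X, hXI, Y, hYI, hXY, by omega, by omega, ?_⟩
  intro x hx x' hx' hne k hk k' hk' hkk
  change good k k' x x'
  rcases lt_or_gt_of_ne hne with h | h <;> rcases lt_or_gt_of_ne hkk with h' | h'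
  · exact (key x hx x' hx' h k hk k' hk' h').2 hdt
  · rw [s1]; exact (key x hx x' hx' h k' hk' k hk h').2 hdt
  · rw [s2]; exact (key x' hx' x hx h k hk k' hk' h').2 hdt
  · rw [s1, s2]; exact (key x' hx' x hx h k' hk' k hk h').2 hdt

theorem popStep (ε : ℝ) (hε : 0 < ε) (q n : ℕ) : ∃ N, ∀ (A : ReducedHG), A.Wicked ε →
    ∀ (K : Fin q → Finset ℕ), Sys A K → Big N K → ∀ (z : Fin q) (F : ℕ → ℕ → ℕ), Tr A F →
    ∃ K' ≤ K, Big n K' ∧ ∃ S, Tr A S ∧ ∀ i j, i ≠ j → i ≠ z → j ≠ z → Meet A ε K z i F j F →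
      Miss A ε K' i j S z F := by
  obtain ⟨N1, h1⟩ := kill ε hε q
  let L : Fin q → (ℕ → ℕ → ℕ) → (ℕ → ℕ → ℕ) → List (Req q) := fun z S F =>
    (Finset.univ : Finset (Fin q × Fin q)).toList.map fun p => ⟨p.1, p.2, S, z, F⟩
  obtain ⟨N2, h2⟩ := homAll q (Fintype.card (Fin q × Fin q)) (max n N1)
  obtain ⟨N3, h3⟩ := popSym ε hε ((q - 1) * N2) N2
  refine ⟨max N2 N3, fun A hA K hK hB z F hF => ?_⟩
  obtain ⟨K0, hK0, hK0c⟩ := trim (K := K) (fun _ => N2) (fun l => (le_max_left _ _).trans (hB l))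
  have hKs := hK.mono hK0
  set B := (Finset.univ.erase z).biUnion K0 with hBd
  have hBI : B ⊆ A.I := Finset.biUnion_subset.2 fun i _ => hKs.sub i
  have hBc : B.card = (q - 1) * N2 := by
    rw [hBd, Finset.card_biUnion (fun i _ j _ hij => hKs.disj i j hij), Finset.sum_congr rfl (fun i _ => hK0c i)]
    simp [Finset.card_erase_of_mem]
  have hBz : ∀ b ∈ B, ∀ u ∈ K z, u ≠ b := by
    intro b hb u hu
    obtain ⟨i, hi, hbi⟩ := Finset.mem_biUnion.1 hb
    exact hK.ne hu (hK0 i hbi) (Finset.ne_of_mem_erase hi).symm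
  obtain ⟨X', hX', hXc, S, hS, hSE⟩ := h3 A B hBI hBc (K z) ((le_max_right _ _).trans (hB z))
    (fun b c u => A.nbhd b c (F u b) (F u c)) (fun b c u => nbhd_comm _ _ _ _ _) (by
      intro b hb c hc hbc u hu
      refine ⟨nbhd_sub _ _ _ _ _, ?_⟩
      have n1 := hBz b hb u hu
      have n2 := hBz c hc u hu
      have uI := hK.sub z hu
      have := hA.1 u b c uI (hBI hb) (hBI hc) n1 n2 hbc _ (hF.mem u uI b (hBI hb) n1) _ (hF.mem u uI c (hBI hc) n2)
      have hp : (0:ℝ) ≤ (A.P b c).card := by positivity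
      nlinarith)
  have hK1 : Function.update K0 z X' ≤ K := by
    intro l
    by_cases h : l = z
    · subst h; simpa using hX'
    · simpa [h] using hK0 l
  obtain ⟨K', hK', hB', hL⟩ := h2 A ε (Function.update K0 z X') (by
    intro l
    by_cases h : l = z
    · subst h; simpa using hXc
    · simp [h, hK0c]) (L z S F) (by simp [L])
  have hKK := hK'.trans hK1
  refine ⟨K', hKK, hB'.mono (le_max_left _ _), S, hS, ?_⟩
  intro i j hij hiz hjz hM
  have hreq : (⟨i, j, S, z, F⟩ : Req q) ∈ L z S F := by
    simp only [L, List.mem_map, Finset.mem_toList, Finset.mem_univ, true_and]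
    exact ⟨(i, j), rfl⟩
  rcases hL _ hreq hij hiz hjz with h | h
  · refine (h1 A hA.2 K' (hK.mono hKK) (hB'.mono (le_max_right _ _)) z i j hiz.symm hjz.symm hij F F S hF hF hS ?_
      (hM.mono hKK) h.symm).elim
    intro u hu b hb c hc
    have hu' := hK' z hu
    have hb' := hK' i hb
    have hc' := hK' j hc
    simp [hiz, hjz] at hu' hb' hc'
    have hbB : b ∈ B := Finset.mem_biUnion.2 ⟨i, by simp [hiz], hb'⟩
    have hcB : c ∈ B := Finset.mem_biUnion.2 ⟨j, by simp [hjz], hc'⟩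
    exact (mem_nbhd.1 (hSE b hbB c hcB (hKs.ne hb' hc' hij) u hu')).2
  · exact h

theorem rs (ε : ℝ) (hε : 0 < ε) (q m : ℕ) (x z : Fin q) (hxz : x ≠ z) : ∃ N, ∀ (A : ReducedHG), A.Wicked ε →
    N ≤ A.I.card → ∃ K : Fin q → Finset ℕ, Sys A K ∧ Big m K ∧ ∃ R S, Tr A R ∧ Tr A S ∧
    ∀ i j k, i ≠ j → i ≠ k → j ≠ k → i ≠ x → i ≠ z → j ≠ x → j ≠ z → k ≠ x → k ≠ z → Miss A ε K i j R k S := by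
  obtain ⟨N1, h1⟩ := triad ε hε q
  obtain ⟨N2, h2⟩ := homAll q (Fintype.card (Fin q × Fin q × Fin q)) (max m N1)
  obtain ⟨N3, h3⟩ := popStep ε hε q N2
  obtain ⟨N4, h4⟩ := popStep ε hε q (N3 + 1)
  obtain ⟨N5, h5⟩ := pairpair ε (q * N4 + N4)
  refine ⟨N5, fun A hA hc => ?_⟩
  obtain ⟨F, hF⟩ := exists_Tr A
  obtain ⟨X, hX, Y, hY, hXY, hXc, hYc, hM⟩ := h5 A hA hc F hF
  obtain ⟨K0, hK0, hK0d, hK0c⟩ := partition q N4 Y (by omega)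
  set K1 := Function.update K0 x X with hK1
  have e1 : K1 x = X := by simp [hK1]
  have e2 : ∀ l, l ≠ x → K1 l = K0 l := by intro l h; simp [hK1, h]
  have hS1 : Sys A K1 := by
    refine ⟨fun l => ?_, fun i j hij => ?_⟩
    · by_cases h : l = x
      · subst h; rw [e1]; exact hX
      · rw [e2 l h]; exact (hK0 l).trans hY
    · by_cases h : i = x
      · subst h; rw [e1, e2 j hij.symm]; exact hXY.mono_right (hK0 j)
      · by_cases h' : j = x
        · subst h'; rw [e1, e2 i h]; exact (hXY.mono_right (hK0 i)).symm
        · rw [e2 i h, e2 j h']; exact hK0d i j hij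
  have hB1 : Big N4 K1 := by
    intro l
    by_cases h : l = x
    · subst h; rw [e1]; omega
    · rw [e2 l h, hK0c]
  have hMF : ∀ i j, i ≠ j → i ≠ x → j ≠ x → Meet A ε K1 x i F j F := by
    intro i j hij hi hj a ha a' ha' hne b hb c hc
    have hbc := hS1.ne hb hc hij
    rw [e1] at ha ha'
    rw [e2 i hi] at hb
    rw [e2 j hj] at hc
    exact hM a ha a' ha' hne b (hK0 i hb) c (hK0 j hc) hbc
  obtain ⟨K2, hK2, hB2, S, hS, hSF⟩ := h4 A hA K1 hS1 hB1 x F hF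
  have hSF' : ∀ i j, i ≠ j → i ≠ x → j ≠ x → Miss A ε K2 i j S x F :=
    fun i j hij hi hj => hSF i j hij hi hj (hMF i j hij hi hj)
  have hS2 := hS1.mono hK2
  have hSz : ∀ i j, i ≠ j → i ≠ x → j ≠ x → i ≠ z → j ≠ z → Meet A ε K2 z i S j S :=
    fun i j hij hi hj hi' hj' => meet_of_miss hA.1 hS2 hS hS hF hi'.symm hj'.symm hxz.symm
      (hB2.nonempty (by omega) x) (hSF' z i hi'.symm hxz.symm hi) (hSF' z j hj'.symm hxz.symm hj)
  obtain ⟨K3, hK3, hB3, R, hR, hRS⟩ := h3 A hA K2 hS2 (hB2.mono (Nat.le_succ _)) z S hS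
  have hS3 := hS2.mono hK3
  obtain ⟨K4, hK4, hB4, hL⟩ := h2 A ε K3 hB3 
    ((Finset.univ : Finset (Fin q × Fin q × Fin q)).toList.map fun p => ⟨p.1, p.2.1, R, p.2.2, S⟩) (by simp)
  have hS4 := hS3.mono hK4
  refine ⟨K4, hS4, hB4.mono (le_max_left _ _), R, S, hR, hS, ?_⟩
  intro i j k hij hik hjk hix hiz hjx hjz hkx hkz
  have hreq := hL ⟨i, j, R, k, S⟩ (by
    simp only [List.mem_map, Finset.mem_toList, Finset.mem_univ, true_and]
    exact ⟨(i, j, k), rfl⟩) hij hik hjk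
  rcases hreq with h | h
  · refine (h1 A hA K4 hS4 (hB4.mono (le_max_right _ _)) i z x j k (by
      simp [hij, hik, hjk, hix, hiz, hjx.symm, hjz.symm, hkx.symm, hkz.symm, hxz.symm]) R S S S F F hR hS hS hS hF hF h
      ((hSz j k hjk hjx hkx hjz hkz).mono (hK4.trans hK3))
      ((hMF j k hjk hjx hkx).mono (hK4.trans (hK3.trans hK2)))
      (Or.inl ((hRS j i hij.symm hjz hiz (hSz j i hij.symm hjx hix hjz hiz)).mono hK4))
      (Or.inr ((hSF' k i hik.symm hkx hix).mono (hK4.trans hK3)))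
      (Or.inl ((hSF' j z hjz hjx hxz.symm).mono (hK4.trans hK3)))).elim
  · exact h
end

section
variable {q : ℕ}

def RSp (A : ReducedHG) (ε : ℝ) (K : Fin q → Finset ℕ) (D : Fin q → Prop) (R S : ℕ → ℕ → ℕ) : Prop :=
  ∀ i j k, D i → D j → D k → i ≠ j → i ≠ k → j ≠ k → Miss A ε K i j R k S

theorem RSp.mono {A : ReducedHG} {ε : ℝ} {K K' : Fin q → Finset ℕ} {D : Fin q → Prop} {R S : ℕ → ℕ → ℕ}
    (h : RSp A ε K D R S) (hK : K' ≤ K) : RSp A ε K' D R S :=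
  fun i j k hi hj hk h1 h2 h3 => (h i j k hi hj hk h1 h2 h3).mono hK

theorem cl1 (ε : ℝ) (hε : 0 < ε) (q : ℕ) : ∃ N, ∀ (A : ReducedHG), A.Wicked ε →
    ∀ (K : Fin q → Finset ℕ), Sys A K → Big N K → ∀ (D : Fin q → Prop) (R S T : ℕ → ℕ → ℕ),
    Tr A R → Tr A S → Tr A T → RSp A ε K D R S → ∀ i j c d e : Fin q, [i, j, c, d, e].Nodup →
    D i → D j → D c → D d → D e → Meet A ε K i j T d R → Meet A ε K i j T c S → False := by
  obtain ⟨N1, h1⟩ := triad ε hε q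
  obtain ⟨N2, h2⟩ := create ε hε q (N1 + 1)
  refine ⟨N2, fun A hA K hK hB D R S T hR hS hT hRS i j c d e hnd Di Dj Dc Dd De m1 m2 => ?_⟩
  have hnd' := hnd
  simp only [List.nodup_cons, List.mem_cons, not_or, List.not_mem_nil, not_false_eq_true, and_true,
    List.nodup_nil] at hnd
  obtain ⟨⟨ij, ic, id, ie⟩, ⟨jc, jd, je⟩, ⟨cd, ce⟩, de⟩ := hnd
  obtain ⟨K', hK', hB', V, hV, -, hv1, hv2⟩ := h2 A hA K hK hB i j d ij id jd T R hT hR m1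
  have hS' := hK.mono hK'
  have r := hRS.mono hK'
  have ne := fun l => hB'.nonempty (by omega) l
  have mV : Meet A ε K' d j V c S := meet_of_miss hA.1 hS' hV hS hR (Ne.symm jd) (Ne.symm cd) (Ne.symm id) (ne i) hv2
    (r d i c Dd Di Dc (Ne.symm id) (Ne.symm cd) ic).symm
  have mR : Meet A ε K' e j R c R := meet_of_miss hA.1 hS' hR hR hS (Ne.symm je) (Ne.symm ce) (Ne.symm ie) (ne i)
    (r e j i De Dj Di (Ne.symm je) (Ne.symm ie) (Ne.symm ij)) (r e c i De Dc Di (Ne.symm ce) (Ne.symm ie) (Ne.symm ic))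
  refine h1 A hA K' hS' (hB'.mono (by omega)) i d e j c ?_ T S V S R R hT hS hV hS hR hR (m2.mono hK') mV mR
    (Or.inl hv1.symm) (Or.inr (r c e i Dc De Di ce (Ne.symm ic) (Ne.symm ie)).symm)
    (Or.inr (r c e d Dc De Dd ce cd (Ne.symm de)).symm)
  simp [ij, ic, id, ie, jc, Ne.symm jd, Ne.symm je, Ne.symm cd, Ne.symm ce, de]

theorem cl2 (ε : ℝ) (hε : 0 < ε) (q : ℕ) : ∃ N, ∀ (A : ReducedHG), A.Wicked ε →
    ∀ (K : Fin q → Finset ℕ), Sys A K → Big N K → ∀ (D : Fin q → Prop) (R S T : ℕ → ℕ → ℕ),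
    Tr A R → Tr A S → Tr A T → RSp A ε K D R S → ∀ i j c d e : Fin q, [i, j, c, d, e].Nodup →
    D i → D j → D c → D d → D e → Meet A ε K i j T c R → Miss A ε K j i T e R → False := by
  obtain ⟨N1, h1⟩ := triad ε hε q
  refine ⟨N1 + 1, fun A hA K hK hB D R S T hR hS hT r i j c d e hnd Di Dj Dc Dd De m1 m2 => ?_⟩
  simp only [List.nodup_cons, List.mem_cons, not_or, List.not_mem_nil, not_false_eq_true, and_true,
    List.nodup_nil] at hnd
  obtain ⟨⟨ij, ic, id, ie⟩, ⟨jc, jd, je⟩, ⟨cd, ce⟩, de⟩ := hnd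
  have ne := fun l => hB.nonempty (by omega) l
  have mS : Meet A ε K d j S c S := meet_of_miss hA.1 hK hS hS hR (Ne.symm jd) (Ne.symm cd) (Ne.symm id) (ne i)
    (r d i j Dd Di Dj (Ne.symm id) (Ne.symm jd) ij).symm (r d i c Dd Di Dc (Ne.symm id) (Ne.symm cd) ic).symm
  have mR : Meet A ε K e j R c R := meet_of_miss hA.1 hK hR hR hS (Ne.symm je) (Ne.symm ce) (Ne.symm ie) (ne i)
    (r e j i De Dj Di (Ne.symm je) (Ne.symm ie) (Ne.symm ij)) (r e c i De Dc Di (Ne.symm ce) (Ne.symm ie) (Ne.symm ic))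
  refine h1 A hA K hK (hB.mono (by omega)) i d e j c ?_ T R S S R R hT hR hS hS hR hR m1 mS mR
    (Or.inr (r c i d Dc Di Dd (Ne.symm ic) cd id)) (Or.inl m2) (Or.inl (r j e d Dj De Dd je jd (Ne.symm de)).symm)
  simp [ij, ic, id, ie, jc, Ne.symm jd, Ne.symm je, Ne.symm cd, Ne.symm ce, de]

/-- flatness with respect to a reference transversal -/
def Flat (A : ReducedHG) (ε : ℝ) (K : Fin q → Finset ℕ) (w : Fin q) (W : ℕ → ℕ → ℕ) (i j : Fin q)
    (T : ℕ → ℕ → ℕ) : Prop := Miss A ε K i j T w W ∧ Miss A ε K j i T w W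

theorem Flat.mono {A : ReducedHG} {ε : ℝ} {K K' : Fin q → Finset ℕ} {w i j : Fin q} {W T : ℕ → ℕ → ℕ}
    (h : Flat A ε K w W i j T) (hK : K' ≤ K) : Flat A ε K' w W i j T := ⟨h.1.mono hK, h.2.mono hK⟩

theorem Flat.symm {A : ReducedHG} {ε : ℝ} {K : Fin q → Finset ℕ} {w i j : Fin q} {W T : ℕ → ℕ → ℕ}
    (h : Flat A ε K w W i j T) : Flat A ε K w W j i T := ⟨h.2, h.1⟩

theorem colour (ε : ℝ) (hε : 0 < ε) (q m : ℕ) : ∃ N, ∀ (A : ReducedHG), A.Wicked ε →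
    ∀ (K : Fin q → Finset ℕ), Sys A K → Big N K → ∀ (D : Fin q → Prop) (R S : ℕ → ℕ → ℕ),
    Tr A R → Tr A S → RSp A ε K D R S → ∀ (T : ℕ → ℕ → ℕ), Tr A T → ∀ i j c d e : Fin q, [i, j, c, d, e].Nodup →
    D i → D j → D c → D d → D e → ∃ K' ≤ K, Big m K' ∧ (Flat A ε K' c S i j T ∨ Flat A ε K' d R i j T) := by
  obtain ⟨N1, h1⟩ := cl1 ε hε q
  obtain ⟨N2, h2⟩ := cl2 ε hε q
  obtain ⟨N3, h3⟩ := homAll q 4 (m + N1 + N2 + 1)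
  refine ⟨N3, fun A hA K hK hB D R S hR hS hRS T hT i j c d e hnd Di Dj Dc Dd De => ?_⟩
  have hnd1 := hnd
  have hnd2 : [j, i, c, d, e].Nodup := by
    simp only [List.nodup_cons, List.mem_cons, not_or, List.not_mem_nil, not_false_eq_true, and_true,
      List.nodup_nil] at hnd ⊢
    tauto
  have hnd3 : [i, j, e, c, d].Nodup := by
    simp only [List.nodup_cons, List.mem_cons, not_or, List.not_mem_nil, not_false_eq_true, and_true,
      List.nodup_nil] at hnd ⊢
    tauto
  have hnd4 : [j, i, e, c, d].Nodup := by
    simp only [List.nodup_cons, List.mem_cons, not_or, List.not_mem_nil, not_false_eq_true, and_true,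
      List.nodup_nil] at hnd ⊢
    tauto
  simp only [List.nodup_cons, List.mem_cons, not_or, List.not_mem_nil, not_false_eq_true, and_true,
    List.nodup_nil] at hnd
  obtain ⟨⟨ij, ic, id, ie⟩, ⟨jc, jd, je⟩, ⟨cd, ce⟩, de⟩ := hnd
  obtain ⟨K', hK', hB', hL⟩ := h3 A ε K hB [⟨i, j, T, c, S⟩, ⟨j, i, T, c, S⟩, ⟨i, j, T, d, R⟩, ⟨j, i, T, d, R⟩] rfl
  have hS' := hK.mono hK'
  have r := hRS.mono hK'
  have ne := fun l => hB'.nonempty (by omega) l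
  refine ⟨K', hK', hB'.mono (by omega), ?_⟩
  have b1 := hB'.mono (show N1 ≤ _ by omega)
  have b2 := hB'.mono (show N2 ≤ _ by omega)
  rcases hL ⟨i, j, T, c, S⟩ (by simp) ij ic jc with ai | ai <;>
  rcases hL ⟨i, j, T, d, R⟩ (by simp) ij id jd with bi | bi
  · exact (h1 A hA K' hS' b1 D R S T hR hS hT r i j c d e hnd1 Di Dj Dc Dd De bi ai).elim
  · rcases hL ⟨j, i, T, d, R⟩ (by simp) (Ne.symm ij) jd id with bj | bj
    · rcases hL ⟨j, i, T, c, S⟩ (by simp) (Ne.symm ij) jc ic with aj | aj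
      · exact (h1 A hA K' hS' b1 D R S T hR hS hT r j i c d e hnd2 Dj Di Dc Dd De bj aj).elim
      · have mm : Meet A ε K' j i T e R := meet_of_miss hA.1 hS' hT hR hS (Ne.symm ij) je jc (ne c) aj
          (r j e c Dj De Dc je jc (Ne.symm ce))
        exact (h2 A hA K' hS' b2 D R S T hR hS hT r j i e c d hnd4 Dj Di De Dc Dd mm bi).elim
    · exact Or.inr ⟨bi, bj⟩
  · rcases hL ⟨j, i, T, c, S⟩ (by simp) (Ne.symm ij) jc ic with aj | aj
    · rcases hL ⟨j, i, T, d, R⟩ (by simp) (Ne.symm ij) jd id with bj | bj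
      · exact (h1 A hA K' hS' b1 D R S T hR hS hT r j i c d e hnd2 Dj Di Dc Dd De bj aj).elim
      · have mm : Meet A ε K' i j T e R := meet_of_miss hA.1 hS' hT hR hS ij ie ic (ne c) ai
          (r i e c Di De Dc ie ic (Ne.symm ce))
        exact (h2 A hA K' hS' b2 D R S T hR hS hT r i j e c d hnd3 Di Dj De Dc Dd mm bj).elim
    · exact Or.inl ⟨ai, aj⟩
  · rcases hL ⟨j, i, T, c, S⟩ (by simp) (Ne.symm ij) jc ic with aj | aj
    · rcases hL ⟨j, i, T, d, R⟩ (by simp) (Ne.symm ij) jd id with bj | bj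
      · exact (h1 A hA K' hS' b1 D R S T hR hS hT r j i c d e hnd2 Dj Di Dc Dd De bj aj).elim
      · exact Or.inr ⟨bi, bj⟩
    · exact Or.inl ⟨ai, aj⟩

theorem colourAll (ε : ℝ) (hε : 0 < ε) (q m n : ℕ) : ∃ N, ∀ (A : ReducedHG), A.Wicked ε →
    ∀ (K : Fin q → Finset ℕ), Sys A K → Big N K → ∀ (D : Fin q → Prop) (R S : ℕ → ℕ → ℕ),
    Tr A R → Tr A S → RSp A ε K D R S → ∀ c d e : Fin q, D c → D d → D e →
    ∀ L : List (Fin q × Fin q × (ℕ → ℕ → ℕ)), L.length = n →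
    (∀ r ∈ L, Tr A r.2.2) → ∃ K' ≤ K, Big m K' ∧
    ∀ r ∈ L, [r.1, r.2.1, c, d, e].Nodup → D r.1 → D r.2.1 →
      (Flat A ε K' c S r.1 r.2.1 r.2.2 ∨ Flat A ε K' d R r.1 r.2.1 r.2.2) := by
  induction n with
  | zero =>
    refine ⟨m, fun A hA K hK hB D R S hR hS hRS c d e Dc Dd De L hL hT => ⟨K, le_rfl, hB, ?_⟩⟩
    rw [List.length_eq_zero_iff] at hL; subst hL; simp
  | succ n ih =>
    obtain ⟨N, hN⟩ := ih
    obtain ⟨N', hN'⟩ := colour ε hε q N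
    refine ⟨max N' N, fun A hA K hK hB D R S hR hS hRS c d e Dc Dd De L hL hT => ?_⟩
    cases L with
    | nil => simp at hL
    | cons r L =>
      have hL' : L.length = n := by simpa using hL
      by_cases hd : [r.1, r.2.1, c, d, e].Nodup ∧ D r.1 ∧ D r.2.1
      · obtain ⟨K1, hK1, hB1, h1⟩ := hN' A hA K hK (hB.mono (le_max_left _ _)) D R S hR hS hRS r.2.2
          (hT r (by simp)) r.1 r.2.1 c d e hd.1 hd.2.1 hd.2.2 Dc Dd De
        obtain ⟨K2, hK2, hB2, h2⟩ := hN A hA K1 (hK.mono hK1) hB1 D R S hR hS (hRS.mono hK1) c d e Dc Dd De L hL'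
          (fun r hr => hT r (by simp [hr]))
        refine ⟨K2, hK2.trans hK1, hB2, ?_⟩
        intro r' hr'
        rcases List.mem_cons.1 hr' with rfl | hr'
        · intro _ _ _
          exact h1.imp (fun h => h.mono hK2) (fun h => h.mono hK2)
        · exact h2 r' hr'
      · obtain ⟨K2, hK2, hB2, h2⟩ := hN A hA K hK (hB.mono (le_max_right _ _)) D R S hR hS hRS c d e Dc Dd De L hL'
          (fun r hr => hT r (by simp [hr]))
        refine ⟨K2, hK2, hB2, ?_⟩
        intro r' hr'
        rcases List.mem_cons.1 hr' with rfl | hr'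
        · intro h1 h2 h3; exact absurd ⟨h1, h2, h3⟩ hd
        · exact h2 r' hr'

theorem monoKill (ε : ℝ) (hε : 0 < ε) (q : ℕ) : ∃ N, ∀ (A : ReducedHG), A.Wicked ε →
    ∀ (K : Fin q → Finset ℕ), Sys A K → Big N K → ∀ (w : Fin q) (W X Y Z : ℕ → ℕ → ℕ),
    Tr A W → Tr A X → Tr A Y → Tr A Z → ∀ i j k : Fin q, i ≠ j → i ≠ k → j ≠ k → i ≠ w → j ≠ w →
    Flat A ε K w W i j X → Flat A ε K w W i k Y → Flat A ε K w W j k Z →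
    (∀ a ∈ K i, ∀ b ∈ K j, ∀ c ∈ K k, A.Edge (X a b) (Y a c) (Z b c)) → False := by
  obtain ⟨N, h⟩ := kill ε hε q
  refine ⟨N + 1, fun A hA K hK hB w W X Y Z hW hX hY hZ i j k ij ik jk iw jw f1 f2 f3 hE => ?_⟩
  have ne := fun l => hB.nonempty (by omega) l
  exact h A hA.2 K hK (hB.mono (by omega)) i j k ij ik jk X Y Z hX hY hZ hE
    (meet_of_miss hA.1 hK hX hY hW ij ik iw (ne w) f1.1 f2.1)
    (meet_of_miss hA.1 hK hX hZ hW ij.symm jk jw (ne w) f1.2 f3.1)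
end

section
variable {q : ℕ}

theorem resample {ι : Type} [Fintype ι] [DecidableEq ι] (S : ι → Finset ℕ) (j : ι) (F : (ι → ℕ) → ℝ) :
    ((S j).card : ℝ) * ∑ x ∈ Fintype.piFinset S, F x =
      ∑ x ∈ Fintype.piFinset S, ∑ y ∈ S j, F (Function.update x j y) := by
  have h1 : ∑ x ∈ Fintype.piFinset S, ∑ y ∈ S j, F (Function.update x j y) =
      ∑ z ∈ Fintype.piFinset S ×ˢ S j, F (Function.update z.1 j z.2) := by
    rw [Finset.sum_product]
  have h2 : ∑ z ∈ Fintype.piFinset S ×ˢ S j, F z.1 = ((S j).card : ℝ) * ∑ x ∈ Fintype.piFinset S, F x := by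
    rw [Finset.sum_product, Finset.mul_sum]
    simp
  rw [h1, ← h2]
  have hm : ∀ z ∈ Fintype.piFinset S ×ˢ S j,
      ((Function.update z.1 j z.2, z.1 j) : (ι → ℕ) × ℕ) ∈ Fintype.piFinset S ×ˢ S j := by
    rintro ⟨x, y⟩ hz
    simp only [Finset.mem_product, Fintype.mem_piFinset] at hz ⊢
    refine ⟨fun i => ?_, hz.1 j⟩
    by_cases h : i = j
    · subst h; simpa using hz.2
    · simpa [h] using hz.1 i
  refine Finset.sum_nbij' (fun z => (Function.update z.1 j z.2, z.1 j))
    (fun z => (Function.update z.1 j z.2, z.1 j)) hm hm ?_ ?_ ?_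
  · rintro ⟨x, y⟩ _; simp
  · rintro ⟨x, y⟩ _; simp
  · rintro ⟨x, y⟩ _; simp

theorem mgf {ι : Type} [Fintype ι] [DecidableEq ι] (S : ι → Finset ℕ) (hS : ∀ j, (S j).Nonempty)
    (H : (ι → ℕ) → ι → Finset ℕ) (l p : ℝ) (hl0 : 0 ≤ l) (hl1 : l ≤ 1) (J : Finset ι)
    (hinv : ∀ j ∈ J, ∀ x y, H (Function.update x j y) = H x)
    (hsub : ∀ x ∈ Fintype.piFinset S, ∀ j ∈ J, H x j ⊆ S j)
    (hcard : ∀ x ∈ Fintype.piFinset S, ∀ j ∈ J, p * ((S j).card : ℝ) ≤ ((H x j).card : ℝ))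
    (hp : p ≤ 1) :
    ∑ x ∈ Fintype.piFinset S, ∏ j ∈ J, (if x j ∈ H x j then l else 1) ≤
      (1 - (1 - l) * p) ^ J.card * ((Fintype.piFinset S).card : ℝ) := by
  induction J using Finset.induction_on with
  | empty => simp
  | insert j0 J hj ih =>
    have ih' := ih (fun j h => hinv j (Finset.mem_insert_of_mem h))
      (fun x hx j h => hsub x hx j (Finset.mem_insert_of_mem h))
      (fun x hx j h => hcard x hx j (Finset.mem_insert_of_mem h))
    have hpos : 0 < ((S j0).card : ℝ) := by exact_mod_cast (hS j0).card_pos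
    have hθ : 0 ≤ 1 - (1 - l) * p := by nlinarith
    have key : ((S j0).card : ℝ) *
        ∑ x ∈ Fintype.piFinset S, ∏ j ∈ insert j0 J, (if x j ∈ H x j then l else 1) ≤
        ((S j0).card : ℝ) * ((1 - (1 - l) * p) *
          ∑ x ∈ Fintype.piFinset S, ∏ j ∈ J, (if x j ∈ H x j then l else 1)) := by
      rw [resample, Finset.mul_sum, Finset.mul_sum]
      apply Finset.sum_le_sum
      intro x hx
      have e1 : ∀ y ∈ S j0, ∏ j ∈ insert j0 J, (if Function.update x j0 y j ∈ H (Function.update x j0 y) j then l else 1)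
          = (if y ∈ H x j0 then l else 1) * ∏ j ∈ J, (if x j ∈ H x j then l else 1) := by
        intro y _
        rw [Finset.prod_insert hj, hinv j0 (Finset.mem_insert_self _ _)]
        congr 1
        · simp
        · apply Finset.prod_congr rfl
          intro j hjJ
          have : j ≠ j0 := fun e => hj (e ▸ hjJ)
          simp [this]
      rw [Finset.sum_congr rfl e1, ← Finset.sum_mul]
      have hW : 0 ≤ ∏ j ∈ J, (if x j ∈ H x j then l else 1) :=
        Finset.prod_nonneg fun j _ => by split_ifs <;> linarith
      have e2 : ∑ y ∈ S j0, (if y ∈ H x j0 then l else (1:ℝ)) = (S j0).card - (1 - l) * (H x j0).card := by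
        have : ∀ y ∈ S j0, (if y ∈ H x j0 then l else (1:ℝ)) = 1 - (1 - l) * (if y ∈ H x j0 then 1 else 0) := by
          intro y _; split_ifs <;> ring
        rw [Finset.sum_congr rfl this, Finset.sum_sub_distrib, ← Finset.mul_sum]
        congr 1
        · simp
        · congr 1
          rw [Finset.sum_boole]
          congr 2
          ext y
          simp only [Finset.mem_filter]
          exact ⟨fun h => h.2, fun h => ⟨hsub x hx j0 (Finset.mem_insert_self _ _) h, h⟩⟩
      rw [e2, ← mul_assoc]
      apply mul_le_mul_of_nonneg_right _ hW
      have := hcard x hx j0 (Finset.mem_insert_self _ _)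
      nlinarith
    have := le_of_mul_le_mul_left key hpos
    rw [Finset.card_insert_of_notMem hj, pow_succ]
    calc _ ≤ _ := this
      _ ≤ (1 - (1 - l) * p) * _ := mul_le_mul_of_nonneg_left ih' hθ
      _ = _ := by ring

theorem rate (ε : ℝ) (hε : 0 < ε) (hε' : ε ≤ 2/3) : ∃ h ρ : ℝ, 0 < h ∧ 0 < ρ ∧ ρ < 1 ∧
    (1 - (1 - Real.exp (-h)) * (1/3 + ε)) * Real.exp (h * (1/3 + ε/2)) ≤ ρ := by
  obtain ⟨h, hh⟩ : ∃ h, h = ε / 4 := ⟨_, rfl⟩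
  have h0 : 0 < h := by rw [hh]; positivity
  have hle : Real.exp (-h) ≤ 1 / (1 + h) := by
    rw [Real.exp_neg, ← one_div]
    apply one_div_le_one_div_of_le (by positivity)
    have := Real.add_one_le_exp h
    linarith
  have hc : h / (1 + h) ≤ 1 - Real.exp (-h) := by
    have : h / (1 + h) = 1 - 1 / (1 + h) := by field_simp; ring
    linarith
  refine ⟨h, Real.exp (-(h / (1+h) * (1/3+ε)) + h * (1/3 + ε/2)), h0, Real.exp_pos _, ?_, ?_⟩
  · rw [Real.exp_lt_one_iff]
    have : h * (1/3 + ε/2) < h / (1+h) * (1/3+ε) := by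
      rw [div_mul_eq_mul_div, lt_div_iff₀ (by positivity), mul_assoc]
      apply mul_lt_mul_of_pos_left _ h0
      rw [hh]; nlinarith
    linarith
  · rw [Real.exp_add]
    apply mul_le_mul_of_nonneg_right _ (Real.exp_pos _).le
    have h1 := Real.add_one_le_exp (-(h / (1+h) * (1/3+ε)))
    have h2 : h / (1+h) * (1/3+ε) ≤ (1 - Real.exp (-h)) * (1/3+ε) :=
      mul_le_mul_of_nonneg_right hc (by positivity)
    linarith

theorem chernoff (ε : ℝ) (hε : 0 < ε) (hε' : ε ≤ 2/3) : ∃ ρ : ℝ, 0 < ρ ∧ ρ < 1 ∧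
    ∀ {ι : Type} [Fintype ι] [DecidableEq ι] (S : ι → Finset ℕ) (_ : ∀ j, (S j).Nonempty)
    (H : (ι → ℕ) → ι → Finset ℕ) (J : Finset ι)
    (_ : ∀ j ∈ J, ∀ x y, H (Function.update x j y) = H x)
    (_ : ∀ x ∈ Fintype.piFinset S, ∀ j ∈ J, H x j ⊆ S j)
    (_ : ∀ x ∈ Fintype.piFinset S, ∀ j ∈ J, (1/3+ε) * ((S j).card : ℝ) ≤ ((H x j).card : ℝ)),
    (((Fintype.piFinset S).filter fun x =>
      ((J.filter fun j => x j ∈ H x j).card : ℝ) < (1/3+ε/2) * J.card).card : ℝ) ≤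
      ρ ^ J.card * ((Fintype.piFinset S).card : ℝ) := by
  obtain ⟨h, ρ, h0, hρ0, hρ1, hρ⟩ := rate ε hε hε'
  refine ⟨ρ, hρ0, hρ1, ?_⟩
  intro ι _ _ S hS H J hinv hsub hcard
  have hl1 : Real.exp (-h) ≤ 1 := by rw [Real.exp_le_one_iff]; linarith
  have hm := mgf S hS H (Real.exp (-h)) (1/3+ε) (Real.exp_pos _).le hl1 J hinv hsub hcard (by linarith)
  set Bad := (Fintype.piFinset S).filter fun x =>
      ((J.filter fun j => x j ∈ H x j).card : ℝ) < (1/3+ε/2) * J.card with hB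
  have hlow : (Bad.card : ℝ) * (Real.exp (-(h * (1/3+ε/2)))) ^ J.card ≤
      ∑ x ∈ Fintype.piFinset S, ∏ j ∈ J, (if x j ∈ H x j then Real.exp (-h) else 1) := by
    calc (Bad.card : ℝ) * (Real.exp (-(h * (1/3+ε/2)))) ^ J.card
        = ∑ x ∈ Bad, (Real.exp (-(h * (1/3+ε/2)))) ^ J.card := by simp
      _ ≤ ∑ x ∈ Bad, ∏ j ∈ J, (if x j ∈ H x j then Real.exp (-h) else 1) := by
        apply Finset.sum_le_sum
        intro x hx
        rw [Finset.prod_ite, Finset.prod_const, Finset.prod_const_one, mul_one, ← Real.exp_nat_mul,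
          ← Real.exp_nat_mul, Real.exp_le_exp]
        have := (Finset.mem_filter.1 hx).2
        nlinarith
      _ ≤ _ := by
        apply Finset.sum_le_sum_of_subset_of_nonneg (Finset.filter_subset _ _)
        intro x _ _
        exact Finset.prod_nonneg fun j _ => by split_ifs <;> positivity
  have h3 : (Bad.card : ℝ) = ((Bad.card : ℝ) * (Real.exp (-(h * (1/3+ε/2)))) ^ J.card) *
      (Real.exp (h * (1/3+ε/2))) ^ J.card := by
    rw [mul_assoc, ← mul_pow, ← Real.exp_add, neg_add_cancel, Real.exp_zero, one_pow, mul_one]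
  have hθ : 0 ≤ 1 - (1 - Real.exp (-h)) * (1/3 + ε) := by
    have := Real.exp_pos (-h)
    nlinarith
  rw [h3]
  calc _ ≤ ((1 - (1 - Real.exp (-h)) * (1/3 + ε)) ^ J.card * ((Fintype.piFinset S).card : ℝ)) *
        (Real.exp (h * (1/3+ε/2))) ^ J.card :=
        mul_le_mul_of_nonneg_right (hlow.trans hm) (by positivity)
    _ = ((1 - (1 - Real.exp (-h)) * (1/3 + ε)) * Real.exp (h * (1/3+ε/2))) ^ J.card *
          ((Fintype.piFinset S).card : ℝ) := by rw [mul_pow]; ring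
    _ ≤ _ := by
      apply mul_le_mul_of_nonneg_right _ (Nat.cast_nonneg _)
      exact pow_le_pow_left₀ (mul_nonneg hθ (Real.exp_pos _).le) hρ _
end

section
variable {q : ℕ}

def Xf (n s : ℕ) (T R S : ℕ → ℕ → ℕ) (x : Fin n × Fin n × Fin s → ℕ) (p a b : ℕ) : ℕ :=
  if p < s then
    (if h : min a b < n ∧ max a b < n ∧ p < s then x (⟨min a b, h.1⟩, ⟨max a b, h.2.1⟩, ⟨p, h.2.2⟩)
      else T a b)
  else if p = s then R a b else S a b

def Sf (A : ReducedHG) (n s : ℕ) (e : Fin n × Fin n × Fin s) : Finset ℕ :=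
  if e.1.1 ∈ A.I ∧ e.2.1.1 ∈ A.I ∧ e.1.1 ≠ e.2.1.1 then A.P e.1.1 e.2.1.1 else {0}

theorem Sf_ne (A : ReducedHG) (n s : ℕ) (e : Fin n × Fin n × Fin s) : (Sf A n s e).Nonempty := by
  unfold Sf
  split_ifs with h
  · exact A.Pnonempty _ _ h.1 h.2.1 h.2.2
  · simp

theorem P_minmax (A : ReducedHG) (a b : ℕ) : A.P (min a b) (max a b) = A.P a b := by
  rcases le_total a b with h | h
  · simp [h]
  · simp [h, A.Psymm a b]

theorem mem_minmax (A : ReducedHG) {a b : ℕ} (ha : a ∈ A.I) (hb : b ∈ A.I) (hab : a ≠ b) :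
    min a b ∈ A.I ∧ max a b ∈ A.I ∧ min a b ≠ max a b := by
  rcases lt_or_gt_of_ne hab with h | h
  · simp [h.le, ha, hb, h.ne]
  · simp [h.le, ha, hb, h.ne]

theorem Xf_Tr {A : ReducedHG} {n s : ℕ} {T R S : ℕ → ℕ → ℕ} (hT : Tr A T) (hR : Tr A R)
    (hS : Tr A S) {x : Fin n × Fin n × Fin s → ℕ} (hx : x ∈ Fintype.piFinset (Sf A n s)) (p : ℕ) :
    Tr A (Xf n s T R S x p) := by
  constructor
  · intro a b
    unfold Xf
    simp only [min_comm a b, max_comm a b, hT.symm a b, hR.symm a b, hS.symm a b]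
  · intro a ha b hb hab
    unfold Xf
    have hm := mem_minmax A ha hb hab
    split_ifs with h1 h2
    · have := Fintype.mem_piFinset.1 hx (⟨min a b, h2.1⟩, ⟨max a b, h2.2.1⟩, ⟨p, h2.2.2⟩)
      unfold Sf at this
      rw [if_pos hm] at this
      simpa only [P_minmax] using this
    · exact hT.mem a ha b hb hab
    · exact hR.mem a ha b hb hab
    · exact hS.mem a ha b hb hab

theorem minmax_ne {a b c : ℕ} (hac : a ≠ c) (hab : a ≠ b) : ¬ (min a b = min b c ∧ max a b = max b c) := by
  omega

theorem Xf_upd {n s : ℕ} {T R S : ℕ → ℕ → ℕ} (x : Fin n × Fin n × Fin s → ℕ)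
    (j : Fin n × Fin n × Fin s) (y p a b : ℕ) (h : ¬ (min a b = j.1.1 ∧ max a b = j.2.1.1)) :
    Xf n s T R S (Function.update x j y) p a b = Xf n s T R S x p a b := by
  unfold Xf
  split_ifs with h1 h2 <;> try rfl
  rw [Function.update_of_ne]
  intro e
  apply h
  rw [← e]
  exact ⟨rfl, rfl⟩

set_option maxHeartbeats 1000000 in
theorem badEvent (ε : ℝ) (hε : 0 < ε) (hε' : ε ≤ 2/3) : ∃ ρ : ℝ, 0 < ρ ∧ ρ < 1 ∧
    ∀ (A : ReducedHG), A.EEDense (1/3+ε) → ∀ n s : ℕ, (∀ a ∈ A.I, a < n) → ∀ T R S, Tr A T → Tr A R → Tr A S →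
    ∀ a ∈ A.I, ∀ b ∈ A.I, ∀ c ∈ A.I, a ≠ b → a ≠ c → b ≠ c → ∀ p p' : ℕ,
    (((Fintype.piFinset (Sf A n s)).filter fun x =>
      (((range s).filter fun r => A.Edge (Xf n s T R S x p a b) (Xf n s T R S x p' a c)
        (Xf n s T R S x r b c)).card : ℝ) < (1/3+ε/2) * s).card : ℝ) ≤
      ρ ^ s * ((Fintype.piFinset (Sf A n s)).card : ℝ) := by
  obtain ⟨ρ, h0, h1, H⟩ := chernoff ε hε hε'
  refine ⟨ρ, h0, h1, ?_⟩
  intro A hA n s hn T R S hT hR hS a ha b hb c hc hab hac hbc p p'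
  have hm := mem_minmax A hb hc hbc
  let g : Fin s ↪ Fin n × Fin n × Fin s :=
    ⟨fun r => (⟨min b c, hn _ hm.1⟩, ⟨max b c, hn _ hm.2.1⟩, r), fun r r' h => by simpa using h⟩
  have hg : ∀ j ∈ Finset.univ.map g, j.1.1 = min b c ∧ j.2.1.1 = max b c := by
    intro j hj
    obtain ⟨r, -, rfl⟩ := Finset.mem_map.1 hj
    exact ⟨rfl, rfl⟩
  have hSg : ∀ j ∈ Finset.univ.map g, Sf A n s j = A.P b c := by
    intro j hj
    unfold Sf
    rw [(hg j hj).1, (hg j hj).2, if_pos hm, P_minmax]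
  have := H (Sf A n s) (Sf_ne A n s)
    (fun x _ => A.nbhd b c (Xf n s T R S x p a b) (Xf n s T R S x p' a c)) (Finset.univ.map g) ?_ ?_ ?_
  · rw [Finset.card_map, Finset.card_univ, Fintype.card_fin] at this
    refine le_trans ?_ this
    apply le_of_eq
    congr 2
    apply Finset.filter_congr
    intro x hx
    have e : ((range s).filter fun r => A.Edge (Xf n s T R S x p a b) (Xf n s T R S x p' a c)
        (Xf n s T R S x r b c)).card = ((Finset.univ.map g).filter fun j => x j ∈
          A.nbhd b c (Xf n s T R S x p a b) (Xf n s T R S x p' a c)).card := by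
      symm
      apply Finset.card_bij (fun j _ => j.2.2.1)
      · intro j hj
        rw [Finset.mem_filter] at hj
        obtain ⟨r, -, rfl⟩ := Finset.mem_map.1 hj.1
        rw [Finset.mem_filter]
        refine ⟨by simp, ?_⟩
        have h3 := (Finset.mem_filter.1 hj.2).2
        have : Xf n s T R S x (g r).2.2.1 b c = x (g r) := by
          unfold Xf
          rw [if_pos (g r).2.2.2, dif_pos ⟨hn _ hm.1, hn _ hm.2.1, (g r).2.2.2⟩]
          rfl
        rw [this]
        exact h3
      · intro j hj j' hj' h
        rw [Finset.mem_filter] at hj hj'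
        obtain ⟨r, -, rfl⟩ := Finset.mem_map.1 hj.1
        obtain ⟨r', -, rfl⟩ := Finset.mem_map.1 hj'.1
        congr 1
        exact Fin.ext h
      · intro r hr
        rw [Finset.mem_filter, Finset.mem_range] at hr
        obtain ⟨hrs, hre⟩ := hr
        have : Xf n s T R S x r b c = x (g ⟨r, hrs⟩) := by
          unfold Xf
          rw [if_pos hrs, dif_pos ⟨hn _ hm.1, hn _ hm.2.1, hrs⟩]
          rfl
        refine ⟨g ⟨r, hrs⟩, ?_, rfl⟩
        rw [Finset.mem_filter]
        refine ⟨Finset.mem_map_of_mem _ (Finset.mem_univ _), ?_⟩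
        unfold ReducedHG.nbhd
        rw [Finset.mem_filter]
        refine ⟨?_, this ▸ hre⟩
        rw [← hSg (g ⟨r, hrs⟩) (Finset.mem_map_of_mem _ (Finset.mem_univ _))]
        exact Fintype.mem_piFinset.1 hx _
    rw [e]
  · intro j hj x y
    obtain ⟨h2, h3⟩ := hg j hj
    funext _
    rw [Xf_upd x j y p a b, Xf_upd x j y p' a c]
    · rw [h2, h3]; omega
    · rw [h2, h3]; omega
  · intro x hx j hj
    rw [hSg j hj]
    exact Finset.filter_subset _ _
  · intro x hx j hj
    rw [hSg j hj]
    exact hA a b c ha hb hc hab hac hbc _ ((Xf_Tr hT hR hS hx p).mem a ha b hb hab) _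
      ((Xf_Tr hT hR hS hx p').mem a ha c hc hac)

def Good (A : ReducedHG) (μ : ℝ) (M : ℕ) (X : ℕ → ℕ → ℕ → ℕ) (a : Fin q → ℕ) : Prop :=
  ∀ i j k : Fin q, i ≠ j → i ≠ k → j ≠ k → ∀ p < M, ∀ p' < M,
    μ ≤ (((range M).filter fun r => A.Edge (X p (a i) (a j)) (X p' (a i) (a k)) (X r (a j) (a k))).card : ℝ)

theorem avg {α β : Type} (Ω : Finset α) (G : Finset β) (hΩ : Ω.Nonempty) (B : α → β → Prop)
    (h : ∀ b ∈ G, ((Ω.filter fun x => B x b).card : ℝ) ≤ 1/2 * Ω.card) :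
    ∃ x ∈ Ω, (1/2 : ℝ) * G.card ≤ ((G.filter fun b => ¬ B x b).card : ℝ) := by
  by_contra hcon
  push Not at hcon
  have h1 : ∑ x ∈ Ω, ((G.filter fun b => B x b).card : ℝ) = ∑ b ∈ G, ((Ω.filter fun x => B x b).card : ℝ) := by
    have := Finset.sum_card_bipartiteAbove_eq_sum_card_bipartiteBelow (s := Ω) (t := G) B
    unfold Finset.bipartiteAbove Finset.bipartiteBelow at this
    exact_mod_cast this
  have h2 : ∑ b ∈ G, ((Ω.filter fun x => B x b).card : ℝ) ≤ ∑ b ∈ G, 1/2 * (Ω.card : ℝ) :=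
    Finset.sum_le_sum h
  have h3 : ∑ x ∈ Ω, (1/2 : ℝ) * G.card < ∑ x ∈ Ω, ((G.filter fun b => B x b).card : ℝ) := by
    apply Finset.sum_lt_sum_of_nonempty hΩ
    intro x hx
    have := hcon x hx
    have h4 := Finset.card_filter_add_card_filter_not (s := G) (fun b => B x b)
    have h5 : ((G.filter fun b => B x b).card : ℝ) + ((G.filter fun b => ¬ B x b).card : ℝ) = G.card := by
      exact_mod_cast h4
    linarith
  simp only [Finset.sum_const, nsmul_eq_mul] at h2 h3
  nlinarith

def BadT (A : ReducedHG) (τ : ℝ) (s : ℕ) (X : ℕ → ℕ → ℕ → ℕ) (a : Fin q → ℕ) : Prop :=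
  ∃ i j k : Fin q, ∃ p p' : Fin (s+2), i ≠ j ∧ i ≠ k ∧ j ≠ k ∧
      (((range s).filter fun r => A.Edge (X p (a i) (a j)) (X p' (a i) (a k))
        (X r (a j) (a k))).card : ℝ) < τ

theorem sampling (ε : ℝ) (hε : 0 < ε) (hε' : ε ≤ 2/3) (q : ℕ) : ∃ s : ℕ, ∀ m, ∃ N, ∀ A : ReducedHG,
    A.Wicked ε → ∀ K : Fin q → Finset ℕ, Sys A K → Big N K → ∀ R S, Tr A R → Tr A S →
    ∃ K' ≤ K, Big m K' ∧ ∃ X : ℕ → ℕ → ℕ → ℕ, (∀ p, Tr A (X p)) ∧ X s = R ∧ X (s+1) = S ∧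
      ∀ a ∈ Fintype.piFinset K', Good A ((1/3+ε/8) * ((s+2 : ℕ) : ℝ)) (s+2) X a := by
  obtain ⟨ρ, hρ0, hρ1, H⟩ := badEvent ε hε hε'
  obtain ⟨s, hs1, hs2⟩ : ∃ s : ℕ, (q:ℝ)^3 * ((s:ℝ)+2)^2 * ρ ^ s ≤ 1/2 ∧
      (1/3+ε/8) * ((s+2 : ℕ) : ℝ) ≤ (1/3+ε/2) * s := by
    have t1 : Filter.Tendsto (fun s : ℕ => (q:ℝ)^3 * ((s:ℝ)+2)^2 * ρ ^ s) Filter.atTop (nhds 0) := by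
      have a2 := tendsto_pow_const_mul_const_pow_of_abs_lt_one 2 (r := ρ) (by rw [abs_of_pos hρ0]; exact hρ1)
      have a1 := tendsto_pow_const_mul_const_pow_of_abs_lt_one 1 (r := ρ) (by rw [abs_of_pos hρ0]; exact hρ1)
      have a0 := tendsto_pow_const_mul_const_pow_of_abs_lt_one 0 (r := ρ) (by rw [abs_of_pos hρ0]; exact hρ1)
      have := (((a2.add (a1.const_mul 4)).add (a0.const_mul 4)).const_mul ((q:ℝ)^3))
      simp only [mul_zero, add_zero] at this
      refine this.congr fun s => ?_
      ring
    have e1 := t1.eventually (ge_mem_nhds (show (0:ℝ) < 1/2 by norm_num))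
    obtain ⟨k, hk⟩ := exists_nat_gt (2 / ε * 4)
    obtain ⟨s, h1, h2⟩ := (e1.and (Filter.eventually_ge_atTop k)).exists
    refine ⟨s, h1, ?_⟩
    have h3 : 2 / ε * 4 < s := lt_of_lt_of_le hk (by exact_mod_cast h2)
    have h4 : 8 < ε * s := by
      have := mul_lt_mul_of_pos_left h3 hε
      have e : ε * (2 / ε * 4) = 8 := by field_simp; norm_num
      linarith
    push_cast
    nlinarith
  refine ⟨s, fun m => ?_⟩
  obtain ⟨n, hn⟩ := box q (1/2) (by norm_num) m
  refine ⟨∑ i, n i, ?_⟩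
  intro A hA K hK hB R S hR hS
  obtain ⟨K1, hK1, hc1⟩ := trim (K := K) n (fun i =>
    (Finset.single_le_sum (f := n) (fun _ _ => Nat.zero_le _) (Finset.mem_univ i)).trans (hB i))
  obtain ⟨T, hT⟩ := exists_Tr A
  have hK1s := hK.mono hK1
  obtain ⟨w, hw⟩ : ∃ w, ∀ a ∈ A.I, a < w :=
    ⟨A.I.sup id + 1, fun a ha => Nat.lt_succ_of_le (Finset.le_sup (f := id) ha)⟩
  obtain ⟨x, hx, hgood⟩ := avg (Fintype.piFinset (Sf A w s)) (Fintype.piFinset K1)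
    (Fintype.piFinset_nonempty.2 (Sf_ne A w s))
    (fun x a =>  BadT A ((1/3+ε/2) * s) s (Xf w s T R S x) a) (by
      intro a ha
      have haK := fun i => Fintype.mem_piFinset.1 ha i
      let Bd : Fin q × Fin q × Fin q × Fin (s+2) × Fin (s+2) → Finset (Fin w × Fin w × Fin s → ℕ) :=
        fun u => (Fintype.piFinset (Sf A w s)).filter fun x => u.1 ≠ u.2.1 ∧ u.1 ≠ u.2.2.1 ∧ u.2.1 ≠ u.2.2.1 ∧
          (((range s).filter fun r => A.Edge (Xf w s T R S x u.2.2.2.1 (a u.1) (a u.2.1))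
            (Xf w s T R S x u.2.2.2.2 (a u.1) (a u.2.2.1))
            (Xf w s T R S x r (a u.2.1) (a u.2.2.1))).card : ℝ) < (1/3+ε/2) * s
      have hBd : ∀ u, ((Bd u).card : ℝ) ≤ ρ ^ s * ((Fintype.piFinset (Sf A w s)).card : ℝ) := by
        rintro ⟨i, j, k, p, p'⟩
        by_cases hd : i ≠ j ∧ i ≠ k ∧ j ≠ k
        · refine le_trans ?_ (H A hA.1 w s hw T R S hT hR hS (a i) (hK1s.sub i (haK i)) (a j)
            (hK1s.sub j (haK j)) (a k) (hK1s.sub k (haK k)) (hK1s.ne (haK i) (haK j) hd.1)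
            (hK1s.ne (haK i) (haK k) hd.2.1) (hK1s.ne (haK j) (haK k) hd.2.2) p p')
          have : Bd (i, j, k, p, p') ⊆ _ :=
            Finset.monotone_filter_right (Fintype.piFinset (Sf A w s)) fun x _ hx => hx.2.2.2
          exact_mod_cast Finset.card_le_card this
        · have : Bd (i, j, k, p, p') = ∅ := by
            apply Finset.filter_eq_empty_iff.2
            intro x _ h
            exact hd ⟨h.1, h.2.1, h.2.2.1⟩
          rw [this]
          simp only [Finset.card_empty, Nat.cast_zero]
          positivity
      have hsub : ((Fintype.piFinset (Sf A w s)).filter fun x =>  BadT A ((1/3+ε/2) * s) s (Xf w s T R S x) a) ⊆ Finset.univ.biUnion Bd := by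
        intro x hx
        obtain ⟨h1, i, j, k, p, p', h⟩ := Finset.mem_filter.1 hx
        exact Finset.mem_biUnion.2 ⟨(i, j, k, p, p'), Finset.mem_univ _, Finset.mem_filter.2 ⟨h1, h⟩⟩
      calc _ ≤ ((Finset.univ.biUnion Bd).card : ℝ) := by exact_mod_cast Finset.card_le_card hsub
        _ ≤ ∑ u, ((Bd u).card : ℝ) := by exact_mod_cast Finset.card_biUnion_le
        _ ≤ ∑ u : Fin q × Fin q × Fin q × Fin (s+2) × Fin (s+2), ρ ^ s * ((Fintype.piFinset (Sf A w s)).card : ℝ) :=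
          Finset.sum_le_sum fun u _ => hBd u
        _ = ((q:ℝ)^3 * ((s:ℝ)+2)^2 * ρ ^ s) * ((Fintype.piFinset (Sf A w s)).card : ℝ) := by
          rw [Finset.sum_const, Finset.card_univ]
          simp only [Fintype.card_prod, Fintype.card_fin, nsmul_eq_mul]
          push_cast
          ring
        _ ≤ _ := mul_le_mul_of_nonneg_right hs1 (Nat.cast_nonneg _))
  obtain ⟨K', hK', hc', hG⟩ := hn K1 hc1 _ (Finset.filter_subset _ _) hgood
  refine ⟨K', fun i => (hK' i).trans (hK1 i), fun i => (hc' i).ge, Xf w s T R S x,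
    Xf_Tr hT hR hS hx, ?_, ?_, ?_⟩
  · funext a b; simp [Xf]
  · funext a b; simp [Xf]
  · intro a ha i j k hij hik hjk p hp p' hp'
    have h1 := (Finset.mem_filter.1 (hG ha)).2
    have h2 : (1/3+ε/2) * s ≤ (((range s).filter fun r => A.Edge (Xf w s T R S x p (a i) (a j)) (Xf w s T R S x p' (a i) (a k))
        (Xf w s T R S x r (a j) (a k))).card : ℝ) := by
      by_contra hlt
      exact h1 ⟨i, j, k, ⟨p, hp⟩, ⟨p', hp'⟩, hij, hik, hjk, not_le.1 hlt⟩
    refine (hs2.trans h2).trans ?_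
    have : (range s) ⊆ range (s+2) := Finset.range_mono (by omega)
    exact_mod_cast Finset.card_le_card (Finset.filter_subset_filter _ this)
end

section
variable {q : ℕ}

def code (i j p : ℕ) : ℕ := Nat.pair (Nat.pair (min i j) (max i j)) p

theorem code_symm (i j p : ℕ) : code i j p = code j i p := by
  unfold code; rw [min_comm, max_comm]

theorem code_inj {i j p k l r : ℕ} (h : code i j p = code k l r) :
    ((i = k ∧ j = l) ∨ (i = l ∧ j = k)) ∧ p = r := by
  unfold code at h
  rw [Nat.pair_eq_pair, Nat.pair_eq_pair] at h
  omega

def BEdge (A : ReducedHG) (t M : ℕ) (a : ℕ → ℕ) (X : ℕ → ℕ → ℕ → ℕ) (x y z : ℕ) : Prop :=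
  ∃ i j k p p' r, (i < t ∧ j < t ∧ k < t) ∧ (i ≠ j ∧ i ≠ k ∧ j ≠ k) ∧ (p < M ∧ p' < M ∧ r < M) ∧
    (x = code i j p ∧ y = code i k p' ∧ z = code j k r) ∧
    A.Edge (X p (a i) (a j)) (X p' (a i) (a k)) (X r (a j) (a k))

def BHG (A : ReducedHG) (t M : ℕ) (hM : 0 < M) (a : ℕ → ℕ) (X : ℕ → ℕ → ℕ → ℕ)
    (hX : ∀ p, Tr A (X p)) : ReducedHG where
  I := range t
  P i j := (range M).image (code i j)
  Psymm i j := by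
    congr 1; funext p; exact code_symm i j p
  Pnonempty i j _ _ _ := ⟨code i j 0, Finset.mem_image_of_mem _ (Finset.mem_range.2 hM)⟩
  Pdisjoint i j k l hij hkl hne := by
    rw [Finset.disjoint_left]
    intro v h1 h2
    obtain ⟨p, -, rfl⟩ := Finset.mem_image.1 h1
    obtain ⟨r, -, h⟩ := Finset.mem_image.1 h2
    rcases (code_inj h).1 with ⟨rfl, rfl⟩ | ⟨rfl, rfl⟩
    · exact hne rfl
    · exact hne (Finset.pair_comm _ _)
  Edge := BEdge A t M a X
  EdgeSymm := by
    rintro x y z ⟨i, j, k, p, p', r, ⟨h1, h2, h3⟩, ⟨h4, h5, h6⟩, ⟨h7, h8, h9⟩, ⟨rfl, rfl, rfl⟩, hE⟩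
    refine ⟨i, k, j, p', p, r, ⟨h1, h3, h2⟩, ⟨h5, h4, h6.symm⟩, ⟨h8, h7, h9⟩,
      ⟨rfl, rfl, code_symm _ _ _⟩, ?_⟩
    rw [(hX r).symm (a k) (a j)]
    exact A.EdgeSymm _ _ _ hE
  EdgeSymm' := by
    rintro x y z ⟨i, j, k, p, p', r, ⟨h1, h2, h3⟩, ⟨h4, h5, h6⟩, ⟨h7, h8, h9⟩, ⟨rfl, rfl, rfl⟩, hE⟩
    refine ⟨j, i, k, p, r, p', ⟨h2, h1, h3⟩, ⟨h4.symm, h6, h5⟩, ⟨h7, h9, h8⟩,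
      ⟨code_symm _ _ _, rfl, rfl⟩, ?_⟩
    rw [(hX p).symm (a j) (a i)]
    exact A.EdgeSymm' _ _ _ hE
  EdgeValid := by
    rintro x y z ⟨i, j, k, p, p', r, ⟨h1, h2, h3⟩, ⟨h4, h5, h6⟩, ⟨h7, h8, h9⟩, ⟨rfl, rfl, rfl⟩, hE⟩
    exact ⟨i, j, k, Finset.mem_range.2 h1, Finset.mem_range.2 h2, Finset.mem_range.2 h3, h4, h5, h6,
      Finset.mem_image_of_mem _ (Finset.mem_range.2 h7), Finset.mem_image_of_mem _ (Finset.mem_range.2 h8),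
      Finset.mem_image_of_mem _ (Finset.mem_range.2 h9)⟩

theorem BEdge_code {A : ReducedHG} {t M : ℕ} {a : ℕ → ℕ} {X : ℕ → ℕ → ℕ → ℕ} {i j k p p' r : ℕ}
    (hij : i ≠ j) (hik : i ≠ k) (hjk : j ≠ k)
    (h : BEdge A t M a X (code i j p) (code i k p') (code j k r)) :
    A.Edge (X p (a i) (a j)) (X p' (a i) (a k)) (X r (a j) (a k)) := by
  obtain ⟨i', j', k', u, u', v, -, ⟨h4, h5, h6⟩, -, ⟨e1, e2, e3⟩, hE⟩ := h
  obtain ⟨e1, rfl⟩ := code_inj e1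
  obtain ⟨e2, rfl⟩ := code_inj e2
  obtain ⟨e3, rfl⟩ := code_inj e3
  obtain ⟨rfl, rfl, rfl⟩ : i = i' ∧ j = j' ∧ k = k' := by omega
  exact hE

theorem build (A : ReducedHG) (hA : ¬ A.SupportsK5) (t M : ℕ) (hM : 0 < M) (a : ℕ → ℕ)
    (ha : ∀ i < t, a i ∈ A.I) (hinj : ∀ i < t, ∀ j < t, i ≠ j → a i ≠ a j) (X : ℕ → ℕ → ℕ → ℕ)
    (hX : ∀ p, Tr A (X p)) (col : ℕ → ℕ → ℕ → Bool) (hc : ∀ i j p, col i j p = col j i p)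
    (hr : ∀ i j, ∃ p < M, col i j p = true) (hb : ∀ i j, ∃ p < M, col i j p = false)
    (hno : ∀ i < t, ∀ j < t, ∀ k < t, i ≠ j → i ≠ k → j ≠ k → ∀ p < M, ∀ p' < M, ∀ r < M,
      A.Edge (X p (a i) (a j)) (X p' (a i) (a k)) (X r (a j) (a k)) →
      ¬ (col i j p = col i k p' ∧ col i k p' = col j k r)) (μ : ℝ)
    (hg : ∀ i < t, ∀ j < t, ∀ k < t, i ≠ j → i ≠ k → j ≠ k → ∀ p < M, ∀ p' < M,
      μ * (M : ℝ) ≤ (((range M).filter fun r =>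
        A.Edge (X p (a i) (a j)) (X p' (a i) (a k)) (X r (a j) (a k))).card : ℝ)) :
    ∃ (B : ReducedHG) (φ : ℕ → Bool), t ≤ B.I.card ∧ ¬ B.SupportsK5 ∧ B.IsBicolouring φ ∧
      B.Tau2Ge φ μ := by
  let φ : ℕ → Bool := fun v => col (Nat.unpair (Nat.unpair v).1).1 (Nat.unpair (Nat.unpair v).1).2 (Nat.unpair v).2
  have hφ : ∀ i j p, φ (code i j p) = col i j p := by
    intro i j p
    simp only [φ, code, Nat.unpair_pair]
    rcases le_total i j with h | h
    · simp [h]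
    · simp [h, hc j i]
  refine ⟨BHG A t M hM a X hX, φ, ?_, ?_, ⟨?_, ?_⟩, ?_⟩
  · simp [BHG]
  · rintro ⟨J, hJ, hJ5, f, hf, hfm, hfE⟩
    apply hA
    have hJt : ∀ i ∈ J, i < t := fun i hi => Finset.mem_range.1 (hJ hi)
    have hfc : ∀ i ∈ J, ∀ j ∈ J, i ≠ j → f i j = code i j (Nat.unpair (f i j)).2 := by
      intro i hi j hj hij
      obtain ⟨p, -, h⟩ := Finset.mem_image.1 (hfm i hi j hj hij)
      rw [← h]; simp [code]
    have hinjJ : Set.InjOn a J := by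
      intro i hi j hj h
      by_contra hne
      exact hinj i (hJt i hi) j (hJt j hj) hne h
    have hinv : ∀ i ∈ J, Function.invFunOn a J (a i) = i := fun i hi =>
      hinjJ.leftInvOn_invFunOn hi
    refine ⟨J.image a, ?_, ?_, fun u v => X (Nat.unpair (f (Function.invFunOn a J u) (Function.invFunOn a J v))).2 u v, ?_, ?_, ?_⟩
    · intro u hu
      obtain ⟨i, hi, rfl⟩ := Finset.mem_image.1 hu
      exact ha i (hJt i hi)
    · rw [Finset.card_image_of_injOn hinjJ, hJ5]
    · simp only [Finset.forall_mem_image]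
      intro i hi j hj
      rw [hinv i hi, hinv j hj, hf i hi j hj]
      exact (hX _).symm _ _
    · simp only [Finset.forall_mem_image]
      intro i hi j hj hne
      exact (hX _).mem _ (ha i (hJt i hi)) _ (ha j (hJt j hj)) hne
    · simp only [Finset.forall_mem_image]
      intro i hi j hj k hk hij hik hjk
      have hij' : i ≠ j := fun e => hij (e ▸ rfl)
      have hik' : i ≠ k := fun e => hik (e ▸ rfl)
      have hjk' : j ≠ k := fun e => hjk (e ▸ rfl)
      rw [hinv i hi, hinv j hj, hinv k hk]
      have := hfE i hi j hj k hk hij' hik' hjk'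
      rw [hfc i hi j hj hij', hfc i hi k hk hik', hfc j hj k hk hjk'] at this
      exact BEdge_code hij' hik' hjk' this
  · intro i hi j hj hij
    obtain ⟨p, hp, h1⟩ := hr i j
    obtain ⟨r, hr', h2⟩ := hb i j
    exact ⟨⟨code i j p, Finset.mem_image_of_mem _ (Finset.mem_range.2 hp), by rw [hφ, h1]⟩,
      ⟨code i j r, Finset.mem_image_of_mem _ (Finset.mem_range.2 hr'), by rw [hφ, h2]⟩⟩
  · rintro x y z ⟨i, j, k, p, p', r, ⟨h1, h2, h3⟩, ⟨h4, h5, h6⟩, ⟨h7, h8, h9⟩, ⟨rfl, rfl, rfl⟩, hE⟩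
    rw [hφ, hφ, hφ]
    exact hno i h1 j h2 k h3 h4 h5 h6 p h7 p' h8 r h9 hE
  · intro i j k hi hj hk hij hik hjk x hx y hy _
    have hi := Finset.mem_range.1 hi
    have hj := Finset.mem_range.1 hj
    have hk := Finset.mem_range.1 hk
    obtain ⟨p, hp, rfl⟩ := Finset.mem_image.1 hx
    obtain ⟨p', hp', rfl⟩ := Finset.mem_image.1 hy
    have hp := Finset.mem_range.1 hp
    have hp' := Finset.mem_range.1 hp'
    have hcinj : Function.Injective (code j k) := fun u v h => (code_inj h).2
    have e1 : ((BHG A t M hM a X hX).P j k).card = M := by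
      show ((range M).image (code j k)).card = M
      rw [Finset.card_image_of_injective _ hcinj, Finset.card_range]
    rw [e1]
    refine (hg i hi j hj k hk hij hik hjk p hp p' hp').trans ?_
    rw [← Finset.card_image_of_injective _ hcinj]
    norm_cast
    apply Finset.card_le_card
    intro v hv
    obtain ⟨r, hr', rfl⟩ := Finset.mem_image.1 hv
    obtain ⟨h1, h2⟩ := Finset.mem_filter.1 hr'
    refine Finset.mem_filter.2 ⟨Finset.mem_image_of_mem _ h1, ?_⟩
    exact ⟨i, j, k, p, p', r, ⟨hi, hj, hk⟩, ⟨hij, hik, hjk⟩, ⟨hp, hp', Finset.mem_range.1 h1⟩, ⟨rfl, rfl, rfl⟩, h2⟩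
end

section
variable {q : ℕ}

theorem tuple3 {K : Fin q → Finset ℕ} (hne : ∀ i, (K i).Nonempty) {i j k : Fin q} (hij : i ≠ j) (hik : i ≠ k)
    (hjk : j ≠ k) {u v w : ℕ} (hu : u ∈ K i) (hv : v ∈ K j) (hw : w ∈ K k) :
    ∃ a ∈ Fintype.piFinset K, a i = u ∧ a j = v ∧ a k = w := by
  obtain ⟨a, ha⟩ := Fintype.piFinset_nonempty.2 hne
  refine ⟨_, upd_mem (upd_mem (upd_mem ha hu) hv) hw, ?_, ?_, ?_⟩
  · rw [Function.update_of_ne hik, Function.update_of_ne hij, Function.update_self]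
  · rw [Function.update_of_ne hjk, Function.update_self]
  · rw [Function.update_self]

theorem final (ε : ℝ) (hε : 0 < ε) (hε' : ε ≤ 2/3) (t : ℕ) : ∃ n₀ : ℕ, ∀ A : ReducedHG,
      n₀ ≤ A.I.card → A.Wicked ε →
      ∃ (B : ReducedHG) (φ : ℕ → Bool),
        t ≤ B.I.card ∧ ¬ B.SupportsK5 ∧ B.IsBicolouring φ ∧
          B.Tau2Ge φ (1/3 + ε/8) := by
  obtain ⟨s, hs⟩ := sampling ε hε hε' (t+5)
  obtain ⟨N1, h1⟩ := monoKill ε hε (t+5)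
  obtain ⟨N2, h2⟩ := boxColor (t+5) (Fin (t+5) × Fin (t+5) × Fin (t+5) × Fin (s+2) × Fin (s+2) × Fin (s+2)) (N1+1)
  obtain ⟨N3, h3⟩ := colourAll ε hε (t+5) (N2+1) (Fintype.card (Fin (t+5) × Fin (t+5) × Fin (s+2)))
  obtain ⟨N4, h4⟩ := hs (N3+1)
  let c0 : Fin (t+5) := ⟨t, by omega⟩
  let d0 : Fin (t+5) := ⟨t+1, by omega⟩
  let e0 : Fin (t+5) := ⟨t+2, by omega⟩
  let x0 : Fin (t+5) := ⟨t+3, by omega⟩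
  let z0 : Fin (t+5) := ⟨t+4, by omega⟩
  obtain ⟨N5, h5⟩ := rs ε hε (t+5) N4 x0 z0 (by simp [x0, z0])
  refine ⟨N5, fun A hcard hA => ?_⟩
  obtain ⟨K0, hK0, hB0, R, S, hR, hS, hRS⟩ := h5 A hA hcard
  let D : Fin (t+5) → Prop := fun i => i ≠ x0 ∧ i ≠ z0
  have hRSp : RSp A ε K0 D R S := fun i j k Di Dj Dk ij ik jk =>
    hRS i j k ij ik jk Di.1 Di.2 Dj.1 Dj.2 Dk.1 Dk.2
  obtain ⟨K1, hK1, hB1, X, hX, hXs, hXs1, hgood⟩ := h4 A hA K0 hK0 hB0 R S hR hS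
  have hDc : D c0 := by simp [D, c0, x0, z0]
  have hDd : D d0 := by simp [D, d0, x0, z0]
  have hDe : D e0 := by simp [D, e0, x0, z0]
  obtain ⟨K2, hK2, hB2, hcol⟩ := h3 A hA K1 (hK0.mono hK1) (hB1.mono (by omega)) D R S hR hS (hRSp.mono hK1)
    c0 d0 e0 hDc hDd hDe
    ((Finset.univ : Finset (Fin (t+5) × Fin (t+5) × Fin (s+2))).toList.map fun u => (u.1, u.2.1, X u.2.2))
    (by rw [List.length_map, Finset.length_toList, Finset.card_univ]) (by
      intro r hr
      obtain ⟨u, -, rfl⟩ := List.mem_map.1 hr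
      exact hX _)
  have hsys2 := (hK0.mono hK1).mono hK2
  have hRS2 : RSp A ε K2 D R S := (hRSp.mono hK1).mono hK2
  have hDt : ∀ i : Fin (t+5), i.1 < t → D i ∧ i ≠ c0 ∧ i ≠ d0 ∧ i ≠ e0 := by
    intro i hi
    simp only [D, c0, d0, e0, x0, z0, Fin.ext_iff, ne_eq]
    omega
  have hflat : ∀ i j : Fin (t+5), i.1 < t → j.1 < t → i ≠ j → ∀ p < s+2,
      (Flat A ε K2 c0 S i j (X p) ∨ Flat A ε K2 d0 R i j (X p)) := by
    intro i j hi hj hij p hp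
    refine hcol (i, j, X p) (List.mem_map.2 ⟨(i, j, ⟨p, hp⟩), by simp, rfl⟩) ?_ (hDt i hi).1 (hDt j hj).1
    have hi' := (hDt i hi).2
    have hj' := (hDt j hj).2
    have hcd : c0 ≠ d0 := by simp [c0, d0]
    have hce : c0 ≠ e0 := by simp [c0, e0]
    have hde : d0 ≠ e0 := by simp [d0, e0]
    simp only [List.nodup_cons, List.mem_cons, not_or, List.not_mem_nil, not_false_eq_true, and_true,
      List.nodup_nil]
    exact ⟨⟨hij, hi'.1, hi'.2.1, hi'.2.2⟩, ⟨hj'.1, hj'.2.1, hj'.2.2⟩, ⟨hcd, hce⟩, hde⟩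
  let col : ℕ → ℕ → ℕ → Bool := fun i j p => decide (p = s ∨ (p ≠ s+1 ∧
    ∃ (hi : i < t+5) (hj : j < t+5), Flat A ε K2 c0 S ⟨i, hi⟩ ⟨j, hj⟩ (X p)))
  have hred : ∀ i j : Fin (t+5), i.1 < t → j.1 < t → i ≠ j → ∀ p < s+2, col i j p = true →
      Flat A ε K2 c0 S i j (X p) := by
    intro i j hi hj hij p hp h
    rcases of_decide_eq_true h with h | ⟨-, _, _, h⟩
    · rw [h, hXs]
      exact ⟨hRS2 i j c0 (hDt i hi).1 (hDt j hj).1 hDc hij (hDt i hi).2.1 (hDt j hj).2.1,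
        hRS2 j i c0 (hDt j hj).1 (hDt i hi).1 hDc hij.symm (hDt j hj).2.1 (hDt i hi).2.1⟩
    · exact h
  have hblue : ∀ i j : Fin (t+5), i.1 < t → j.1 < t → i ≠ j → ∀ p < s+2, col i j p = false →
      Flat A ε K2 d0 R i j (X p) := by
    intro i j hi hj hij p hp h
    have h' := of_decide_eq_false h
    by_cases hps : p = s+1
    · rw [hps, hXs1]
      exact ⟨(hRS2 i d0 j (hDt i hi).1 hDd (hDt j hj).1 (hDt i hi).2.2.1 hij (hDt j hj).2.2.1.symm).symm,
        (hRS2 j d0 i (hDt j hj).1 hDd (hDt i hi).1 (hDt j hj).2.2.1 hij.symm (hDt i hi).2.2.1.symm).symm⟩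
    · rcases hflat i j hi hj hij p hp with h | h
      · exact absurd (Or.inr ⟨hps, i.2, j.2, h⟩) h'
      · exact h
  have hmain : ∃ a ∈ Fintype.piFinset K2, ∀ i j k : Fin (t+5), ∀ p p' r : Fin (s+2),
      ¬ ((i.1 < t ∧ j.1 < t ∧ k.1 < t) ∧ (i ≠ j ∧ i ≠ k ∧ j ≠ k) ∧
      A.Edge (X p (a i) (a j)) (X p' (a i) (a k)) (X r (a j) (a k)) ∧
      col i j p = col i k p' ∧ col i k p' = col j k r) := by
    by_contra hcon
    push Not at hcon
    obtain ⟨K3, hK3, hB3, ⟨i, j, k, p, p', r⟩, hQ⟩ := h2 K2 (hB2.mono (by omega))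
      (fun u a => (u.1.1 < t ∧ u.2.1.1 < t ∧ u.2.2.1.1 < t) ∧ (u.1 ≠ u.2.1 ∧ u.1 ≠ u.2.2.1 ∧ u.2.1 ≠ u.2.2.1) ∧
        A.Edge (X u.2.2.2.1 (a u.1) (a u.2.1)) (X u.2.2.2.2.1 (a u.1) (a u.2.2.1))
          (X u.2.2.2.2.2 (a u.2.1) (a u.2.2.1)) ∧
        col u.1 u.2.1 u.2.2.2.1 = col u.1 u.2.2.1 u.2.2.2.2.1 ∧
        col u.1 u.2.2.1 u.2.2.2.2.1 = col u.2.1 u.2.2.1 u.2.2.2.2.2) (by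
      intro a ha
      obtain ⟨i, j, k, p, p', r, h⟩ := hcon a ha
      exact ⟨(i, j, k, p, p', r), h⟩)
    have hne : ∀ i, (K3 i).Nonempty := hB3.nonempty (by omega)
    obtain ⟨a0, ha0⟩ := Fintype.piFinset_nonempty.2 hne
    obtain ⟨⟨hi, hj, hk⟩, ⟨hij, hik, hjk⟩, -, e1, e2⟩ := hQ a0 ha0
    dsimp only at hi hj hk hij hik hjk e1 e2
    have hE : ∀ a ∈ K3 i, ∀ b ∈ K3 j, ∀ c ∈ K3 k, A.Edge (X p a b) (X p' a c) (X r b c) := by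
      intro u hu v hv w hw
      obtain ⟨a, ha, rfl, rfl, rfl⟩ := tuple3 hne hij hik hjk hu hv hw
      exact (hQ a ha).2.2.1
    have hsys3 := hsys2.mono hK3
    have hB3' : Big N1 K3 := hB3.mono (by omega)
    cases hcl : col i j p with
    | true =>
      rw [hcl] at e1
      rw [← e1] at e2
      exact h1 A hA K3 hsys3 hB3' c0 S (X p) (X p') (X r) hS (hX _) (hX _) (hX _) i j k hij hik hjk
        (hDt i hi).2.1 (hDt j hj).2.1 ((hred i j hi hj hij p p.2 hcl).mono hK3)
        ((hred i k hi hk hik p' p'.2 e1.symm).mono hK3) ((hred j k hj hk hjk r r.2 e2.symm).mono hK3) hE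
    | false =>
      rw [hcl] at e1
      rw [← e1] at e2
      exact h1 A hA K3 hsys3 hB3' d0 R (X p) (X p') (X r) hR (hX _) (hX _) (hX _) i j k hij hik hjk
        (hDt i hi).2.2.1 (hDt j hj).2.2.1 ((hblue i j hi hj hij p p.2 hcl).mono hK3)
        ((hblue i k hi hk hik p' p'.2 e1.symm).mono hK3) ((hblue j k hj hk hjk r r.2 e2.symm).mono hK3) hE
  obtain ⟨a, ha, hno⟩ := hmain
  have haK := fun i => Fintype.mem_piFinset.1 ha i
  let a' : ℕ → ℕ := fun i => if h : i < t+5 then a ⟨i, h⟩ else 0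
  have ha' : ∀ i (h : i < t), a' i = a ⟨i, by omega⟩ := by
    intro i h
    simp only [a']
    rw [dif_pos (by omega)]
  refine build A hA.2 t (s+2) (by omega) a' ?_ ?_ X hX col ?_ ?_ ?_ ?_ (1/3+ε/8) ?_
  · intro i hi
    rw [ha' i hi]
    exact hsys2.sub _ (haK _)
  · intro i hi j hj hij
    rw [ha' i hi, ha' j hj]
    exact hsys2.ne (haK _) (haK _) (fun e => hij (Fin.ext_iff.1 e))
  · intro i j p
    simp only [col]
    apply decide_eq_decide.2
    constructor
    · rintro (h | ⟨h, hi, hj, hf⟩)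
      · exact Or.inl h
      · exact Or.inr ⟨h, hj, hi, hf.symm⟩
    · rintro (h | ⟨h, hi, hj, hf⟩)
      · exact Or.inl h
      · exact Or.inr ⟨h, hj, hi, hf.symm⟩
  · intro i j
    exact ⟨s, by omega, by simp [col]⟩
  · intro i j
    exact ⟨s+1, by omega, by simp [col]⟩
  · intro i hi j hj k hk hij hik hjk p hp p' hp' r hr hE hc
    rw [ha' i hi, ha' j hj, ha' k hk] at hE
    exact hno ⟨i, by omega⟩ ⟨j, by omega⟩ ⟨k, by omega⟩ ⟨p, hp⟩ ⟨p', hp'⟩ ⟨r, hr⟩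
      ⟨⟨hi, hj, hk⟩, ⟨fun e => hij (Fin.ext_iff.1 e), fun e => hik (Fin.ext_iff.1 e),
        fun e => hjk (Fin.ext_iff.1 e)⟩, hE, hc.1, hc.2⟩
  · intro i hi j hj k hk hij hik hjk p hp p' hp'
    rw [ha' i hi, ha' j hj, ha' k hk]
    exact hgood a (Fintype.piFinset_subset _ _ hK2 ha) ⟨i, by omega⟩ ⟨j, by omega⟩ ⟨k, by omega⟩
      (fun e => hij (Fin.ext_iff.1 e)) (fun e => hik (Fin.ext_iff.1 e)) (fun e => hjk (Fin.ext_iff.1 e)) p hp p' hp'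

theorem trivialCase (ε : ℝ) (hε : 2/3 < ε) (A : ReducedHG) (hc : 3 ≤ A.I.card) (hA : A.Wicked ε) : False := by
  obtain ⟨J, hJ, hJ3⟩ := Finset.exists_subset_card_eq hc
  obtain ⟨i, j, k, hij, hik, hjk, rfl⟩ := Finset.card_eq_three.1 hJ3
  have hi : i ∈ A.I := hJ (by simp)
  have hj : j ∈ A.I := hJ (by simp)
  have hk : k ∈ A.I := hJ (by simp)
  obtain ⟨x, hx⟩ := A.Pnonempty i j hi hj hij
  obtain ⟨y, hy⟩ := A.Pnonempty i k hi hk hik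
  have h1 := hA.1 i j k hi hj hk hij hik hjk x hx y hy
  have h2 : ((A.nbhd j k x y).card : ℝ) ≤ (A.P j k).card := by
    exact_mod_cast Finset.card_le_card (Finset.filter_subset _ _)
  have h3 : (0:ℝ) < (A.P j k).card := by exact_mod_cast (A.Pnonempty j k hj hk hjk).card_pos
  nlinarith

theorem mainThm :
    ∀ (ε : ℝ) (t : ℕ), 0 < ε → ∃ n₀ : ℕ, ∀ A : ReducedHG,
      n₀ ≤ A.I.card → A.Wicked ε →
      ∃ (B : ReducedHG) (φ : ℕ → Bool),
        t ≤ B.I.card ∧ ¬ B.SupportsK5 ∧ B.IsBicolouring φ ∧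
          B.Tau2Ge φ (1/3 + ε/8) := by
  intro ε t hε
  by_cases h : ε ≤ 2/3
  · exact final ε hε h t
  · exact ⟨3, fun A hc hA => (trivialCase ε (not_le.1 h) A hc hA).elim⟩
end

/-- Proposition 5 (`prop:reduction`): every sufficiently large `ε`-wicked reduced hypergraph
yields a bicoloured reduced hypergraph, not supporting a `K₅⁽³⁾`, with large index set and
minimum monochromatic codegree density at least `1/3 + ε/8`. -/
theorem reduction_to_bicoloured :
    ∀ (ε : ℝ) (t : ℕ), 0 < ε → ∃ n₀ : ℕ, ∀ A : ReducedHG,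
      n₀ ≤ A.I.card → A.Wicked ε →
      ∃ (B : ReducedHG) (φ : ℕ → Bool),
        t ≤ B.I.card ∧ ¬ B.SupportsK5 ∧ B.IsBicolouring φ ∧
          B.Tau2Ge φ (1/3 + ε/8) := by
  exact mainThm
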